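/- Let (Λ,η) be an isothermic surface in S^n and let p(t) = Σ_{k=0}^d p_k t^k be a polynomial conserved quantity of (Λ,η) of degree d. Then: (1) the coefficient p_0 is a constant vector in ℝ^{n+1,1}; (2) the top coefficient p_d is a section of V_csc^⊥ which is parallel with respect to the normal connection ∇^⊥; and (3) every coefficient of the real polynomial t ↦ (p(t),p(t)) is constant on Σ. -/

import Mathlib

noncomputable section

open Finset

/-- Minkowski space `ℝ^{n+1,1}`, modelled on `Fin (n+2) → ℝ`. -/
abbrev MV (n : ℕ) : Type := EuclideanSpace ℝ (Fin (n + 2))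

/-- The Minkowski inner product of signature `(n+1,1)`. -/
def mink (n : ℕ) (x y : MV n) : ℝ :=
  ∑ i : Fin (n + 1), x i.castSucc * y i.castSucc
    - x (Fin.last (n + 1)) * y (Fin.last (n + 1))

/-- The light cone `L ⊂ ℝ^{n+1,1}`. -/
def LightCone (n : ℕ) : Set (MV n) := {v | v ≠ 0 ∧ mink n v v = 0}

/-- The skew endomorphism `u ∧ v`, acting by `(u ∧ v) w = (u,w)v − (v,w)u`. -/
def wedge (n : ℕ) (u v w : MV n) : MV n :=
  mink n u w • v - mink n v w • u

/-- The surface domain: a two-dimensional coordinate chart. -/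
abbrev Surf : Type := ℝ × ℝ

/-- the coordinate direction ∂/∂u -/
def du : Surf := (1, 0)

/-- the coordinate direction ∂/∂v -/
def dv : Surf := (0, 1)

/-- partial derivative of a section in a coordinate direction -/
def pd {n : ℕ} (e : Surf) (f : Surf → MV n) (x : Surf) : MV n :=
  fderiv ℝ f x e

lemma mink_add_left (n : ℕ) (a b c : MV n) :
    mink n (a + b) c = mink n a c + mink n b c := by
  simp [mink, PiLp.add_apply, add_mul, Finset.sum_add_distrib]; ring

lemma mink_smul_left (n : ℕ) (r : ℝ) (a c : MV n) :
    mink n (r • a) c = r * mink n a c := by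
  simp [mink, PiLp.smul_apply, smul_eq_mul, mul_sub, Finset.mul_sum, mul_assoc]

lemma mink_zero_left (n : ℕ) (c : MV n) : mink n 0 c = 0 := by
  simp [mink]

/-- An isothermic surface `(Λ,η)` in `S^n = P(L)`, given by a nowhere-zero null
lift `F` of the immersion `Λ` together with the 1-form
`η = F ∧ W₁ du + F ∧ W₂ dv` with values in `Λ ∧ Λ^⊥`. -/
structure IsothermicSurface (n : ℕ) : Type where
  F : Surf → MV n
  W₁ : Surf → MV n
  W₂ : Surf → MV n
  smooth_F : ContDiff ℝ (⊤ : ℕ∞) F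
  smooth_W₁ : ContDiff ℝ (⊤ : ℕ∞) W₁
  smooth_W₂ : ContDiff ℝ (⊤ : ℕ∞) W₂
  F_ne : ∀ x, F x ≠ 0
  F_null : ∀ x, mink n (F x) (F x) = 0
  immersed : ∀ x, LinearIndependent ℝ ![F x, pd du F x, pd dv F x]
  W₁_perp : ∀ x, mink n (F x) (W₁ x) = 0
  W₂_perp : ∀ x, mink n (F x) (W₂ x) = 0
  eta_ne : ∃ x z, wedge n (F x) (W₁ x) z ≠ 0 ∨ wedge n (F x) (W₂ x) z ≠ 0
  eta_closed : ∀ x z,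
    fderiv ℝ (fun y => wedge n (F y) (W₂ y) z) x du
      = fderiv ℝ (fun y => wedge n (F y) (W₁ y) z) x dv

/-- `s` is a parallel section for the flat connection `∇^t = d + tη`. -/
def ParallelSection (n : ℕ) (S : IsothermicSurface n) (t : ℝ)
    (s : Surf → MV n) : Prop :=
  ∀ x, fderiv ℝ s x du + t • wedge n (S.F x) (S.W₁ x) (s x) = 0
     ∧ fderiv ℝ s x dv + t • wedge n (S.F x) (S.W₂ x) (s x) = 0

/-- A polynomial conserved quantity of degree `d` of the isothermic surface
`(Λ,η)`: a polynomial `p(t) = Σ_{k=0}^d p_k t^k` of (smooth) sections, of exact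
degree `d`, with `∇^t p(t) = 0` for all `t`. -/
structure PolyConservedQuantity (n : ℕ) (S : IsothermicSurface n) (d : ℕ) : Type where
  coeff : ℕ → Surf → MV n
  smooth : ∀ k, ContDiff ℝ (⊤ : ℕ∞) (coeff k)
  coeff_eq_zero : ∀ k, d < k → coeff k = 0
  top_ne : coeff d ≠ 0
  conserved : ∀ t : ℝ, ParallelSection n S t
    (fun x => ∑ k ∈ Finset.range (d + 1), t ^ k • coeff k x)

/-- evaluation `p(t)` of a polynomial conserved quantity -/
def pcEval {n : ℕ} {S : IsothermicSurface n} {d : ℕ}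
    (p : PolyConservedQuantity n S d) (t : ℝ) (x : Surf) : MV n :=
  ∑ k ∈ Finset.range (d + 1), t ^ k • p.coeff k x

/-- `(Λ,η)` is a special isothermic surface of type `d`. -/
def SpecialOfType (n : ℕ) (S : IsothermicSurface n) (d : ℕ) : Prop :=
  Nonempty (PolyConservedQuantity n S d)

/-- `p₀ ∈ ⟨w⟩`: the polynomial conserved quantity exhibits `(Λ,η)` as special
isothermic in the space-form `E(w)`. -/
def InSpaceForm {n : ℕ} {S : IsothermicSurface n} {d : ℕ}
    (p : PolyConservedQuantity n S d) (w : MV n) : Prop :=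
  ∃ c : ℝ, ∀ x, p.coeff 0 x = c • w

/-- fullness: the image of `Λ` lies in no proper subsphere -/
def Full (n : ℕ) (S : IsothermicSurface n) : Prop :=
  ¬ ∃ p : MV n, p ≠ 0 ∧ ∀ x, mink n p (S.F x) = 0
/-- A Darboux transform `Λ̂` of `(Λ,η)` with parameter `m`, given by a
`∇^m`-parallel null lift `G` spanning an immersed surface with `Λ̂ ∩ Λ = 0`. -/
structure DarbouxTransform (n : ℕ) (S : IsothermicSurface n) (m : ℝ) : Type where
  G : Surf → MV n
  smooth_G : ContDiff ℝ (⊤ : ℕ∞) G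
  G_ne : ∀ x, G x ≠ 0
  G_null : ∀ x, mink n (G x) (G x) = 0
  immersed : ∀ x, LinearIndependent ℝ ![G x, pd du G x, pd dv G x]
  disjoint : ∀ x, G x ∉ Submodule.span ℝ {S.F x}
  parallel : ParallelSection n S m G

/-- The gauge transformation `Γ_{⟨F⟩}^{⟨G⟩}(c)`: acts as `c` on `⟨G⟩`, as `1` on
`(⟨F⟩ ⊕ ⟨G⟩)^⊥` and as `c⁻¹` on `⟨F⟩`. -/
def gaugeG (n : ℕ) (F G : MV n) (c : ℝ) (z : MV n) : MV n :=
  ((mink n G z / mink n F G) / c) • F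
    + (c * (mink n F z / mink n F G)) • G
    + (z - (mink n G z / mink n F G) • F - (mink n F z / mink n F G) • G)

/-- `Γ_Λ^{Λ̂}(1 − t/m) · (d + tη) = d + tη̂` for all `t ≠ m`: the gauge relation
between the pencils of flat connections of an isothermic surface `S` and of (an
isothermic structure `T` on) its Darboux transform with parameter `m`. -/
def GaugeRel (n : ℕ) (S T : IsothermicSurface n) (m : ℝ) : Prop :=
  ∀ t : ℝ, t ≠ m → ∀ s : Surf → MV n, ContDiff ℝ (⊤ : ℕ∞) s → ∀ x : Surf,
    (fderiv ℝ (fun y => gaugeG n (S.F y) (T.F y) (1 - t / m) (s y)) x du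
        + t • wedge n (T.F x) (T.W₁ x) (gaugeG n (S.F x) (T.F x) (1 - t / m) (s x))
      = gaugeG n (S.F x) (T.F x) (1 - t / m)
          (fderiv ℝ s x du + t • wedge n (S.F x) (S.W₁ x) (s x)))
    ∧ (fderiv ℝ (fun y => gaugeG n (S.F y) (T.F y) (1 - t / m) (s y)) x dv
        + t • wedge n (T.F x) (T.W₂ x) (gaugeG n (S.F x) (T.F x) (1 - t / m) (s x))
      = gaugeG n (S.F x) (T.F x) (1 - t / m)
          (fderiv ℝ s x dv + t • wedge n (S.F x) (S.W₂ x) (s x)))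

/-- `Λ̂ = ⟨p(m)⟩` with `(p(m),p(m)) = 0`: the Darboux transform `D` is a
complementary surface of `(Λ,η)` with respect to `p(t)`. -/
def IsComplementary (n : ℕ) {S : IsothermicSurface n} {d : ℕ}
    (p : PolyConservedQuantity n S d) {m : ℝ} (D : DarbouxTransform n S m) : Prop :=
  (∀ x, mink n (pcEval p m x) (pcEval p m x) = 0) ∧
  (∀ x, Submodule.span ℝ {D.G x} = Submodule.span ℝ {pcEval p m x})

/-- `m` is a repeated root of the (constant-coefficient) polynomial `(p(t),p(t))`. -/
def IsRepeatedRootAt {n : ℕ} {S : IsothermicSurface n} {d : ℕ}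
    (p : PolyConservedQuantity n S d) (m : ℝ) : Prop :=
  ∀ x, mink n (pcEval p m x) (pcEval p m x) = 0
    ∧ deriv (fun t : ℝ => mink n (pcEval p t x) (pcEval p t x)) m = 0
/-- metric coefficient `g₁₁ = (F_u,F_u)` of the induced metric -/
def gUU (n : ℕ) (F : Surf → MV n) (x : Surf) : ℝ := mink n (pd du F x) (pd du F x)

/-- metric coefficient `g₁₂ = (F_u,F_v)` -/
def gUV (n : ℕ) (F : Surf → MV n) (x : Surf) : ℝ := mink n (pd du F x) (pd dv F x)

/-- metric coefficient `g₂₂ = (F_v,F_v)` -/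
def gVV (n : ℕ) (F : Surf → MV n) (x : Surf) : ℝ := mink n (pd dv F x) (pd dv F x)

/-- `(𝐇, N)`, the inner product of the mean curvature vector of `F` (in a
space-form `E(w)`) with a normal field `N`: half the trace with respect to the
induced metric of the `N`-component of the second fundamental form. -/
def meanCurv (n : ℕ) (F N : Surf → MV n) (x : Surf) : ℝ :=
  (gVV n F x * mink n (pd du (pd du F) x) (N x)
    - 2 * gUV n F x * mink n (pd du (pd dv F) x) (N x)
    + gUU n F x * mink n (pd dv (pd dv F) x) (N x))
  / (2 * (gUU n F x * gVV n F x - gUV n F x ^ 2))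

/-- `N` is a unit normal field of the lift `F : Σ → E(w)`. -/
def IsUnitNormal (n : ℕ) (F N : Surf → MV n) (w : MV n) : Prop :=
  (∀ x, mink n (N x) (N x) = 1) ∧ (∀ x, mink n (N x) w = 0)
    ∧ (∀ x, mink n (N x) (F x) = 0)
    ∧ (∀ x, mink n (N x) (pd du F x) = 0) ∧ (∀ x, mink n (N x) (pd dv F x) = 0)

/-- `N` is parallel for the normal connection of `F : Σ → E(w)`: the derivative
of `N` has no component in the normal bundle of `F` in `E(w)`. -/
def ParallelNormal (n : ℕ) (F N : Surf → MV n) (w : MV n) : Prop :=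
  ∀ x e, fderiv ℝ N x e ∈ Submodule.span ℝ {F x, pd du F x, pd dv F x, w}

/-- the chart coordinates `(u,v)` are conformal curvature line coordinates
corresponding to `η`, with conformal factor `e^{2θ}`:
`I = e^{2θ}(du² + dv²)` and `η = e^{−2θ} F ∧ (−F_u du + F_v dv)`. -/
def ConformalCoords (n : ℕ) (S : IsothermicSurface n) (θ : Surf → ℝ) : Prop :=
  ContDiff ℝ (⊤ : ℕ∞) θ
  ∧ (∀ x, mink n (pd du S.F x) (pd du S.F x) = Real.exp (2 * θ x))
  ∧ (∀ x, mink n (pd dv S.F x) (pd dv S.F x) = Real.exp (2 * θ x))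
  ∧ (∀ x, mink n (pd du S.F x) (pd dv S.F x) = 0)
  ∧ (∀ x z, wedge n (S.F x) (S.W₁ x) z
      = Real.exp (-(2 * θ x)) • wedge n (S.F x) (-pd du S.F x) z)
  ∧ (∀ x z, wedge n (S.F x) (S.W₂ x) z
      = Real.exp (-(2 * θ x)) • wedge n (S.F x) (pd dv S.F x) z)

/-- the second fundamental form of the lift `F` in `E(w)` with respect to the
unit normal `N` is `II = e^{2θ}(k₁ du² + k₂ dv²)`. -/
def PrincipalCurvatures (n : ℕ) (S : IsothermicSurface n) (N : Surf → MV n)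
    (θ k₁ k₂ : Surf → ℝ) : Prop :=
  (∀ x, mink n (pd du (pd du S.F) x) (N x) = Real.exp (2 * θ x) * k₁ x)
  ∧ (∀ x, mink n (pd du (pd dv S.F) x) (N x) = 0)
  ∧ (∀ x, mink n (pd dv (pd dv S.F) x) (N x) = Real.exp (2 * θ x) * k₂ x)

/-- partial derivative of a real function on the surface -/
def pdR (e : Surf) (f : Surf → ℝ) (x : Surf) : ℝ := fderiv ℝ f x e
/-- `(Λ^c, η^c)` is the Christoffel transform of `(Λ,η)` with respect to the
pair `(v∞, v₀)`, witnessed by the stereoprojections `f`, `f^c` into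
`ℝ^n = ⟨v₀,v∞⟩^⊥`:  `F = exp(f ∧ v∞)v₀`, `F^c = exp(f^c ∧ v₀)v∞`,
`η = Ad(exp(f ∧ v∞))(df^c ∧ v₀)` and `η^c = Ad(exp(f^c ∧ v₀))(df ∧ v∞)`. -/
def IsChristoffelPair (n : ℕ) (S Sc : IsothermicSurface n) (vinf v0 : MV n)
    (f fc : Surf → MV n) : Prop :=
  vinf ∈ LightCone n ∧ v0 ∈ LightCone n ∧ mink n v0 vinf = -1
  ∧ ContDiff ℝ (⊤ : ℕ∞) f ∧ ContDiff ℝ (⊤ : ℕ∞) fc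
  ∧ (∀ x, mink n (f x) v0 = 0) ∧ (∀ x, mink n (f x) vinf = 0)
  ∧ (∀ x, mink n (fc x) v0 = 0) ∧ (∀ x, mink n (fc x) vinf = 0)
  ∧ (∀ x, S.F x = v0 + f x + (mink n (f x) (f x) / 2) • vinf)
  ∧ (∀ x, Sc.F x = vinf + fc x + (mink n (fc x) (fc x) / 2) • v0)
  ∧ (∀ x z, wedge n (S.F x) (S.W₁ x) z
      = wedge n (pd du fc x + mink n (f x) (pd du fc x) • vinf) (S.F x) z)
  ∧ (∀ x z, wedge n (S.F x) (S.W₂ x) z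
      = wedge n (pd dv fc x + mink n (f x) (pd dv fc x) • vinf) (S.F x) z)
  ∧ (∀ x z, wedge n (Sc.F x) (Sc.W₁ x) z
      = wedge n (pd du f x + mink n (fc x) (pd du f x) • v0) (Sc.F x) z)
  ∧ (∀ x z, wedge n (Sc.F x) (Sc.W₂ x) z
      = wedge n (pd dv f x + mink n (fc x) (pd dv f x) • v0) (Sc.F x) z)

/-- `Φ` is an orthogonal gauge transformation with `Φ · (d + sη) = d`. -/
def IsTGauge (n : ℕ) (S : IsothermicSurface n) (s : ℝ)
    (Φ : Surf → MV n → MV n) : Prop :=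
  (∀ x, IsLinearMap ℝ (Φ x))
  ∧ (∀ x z z', mink n (Φ x z) (Φ x z') = mink n z z')
  ∧ (∀ σ : Surf → MV n, ContDiff ℝ (⊤ : ℕ∞) σ → ∀ x,
      (fderiv ℝ (fun y => Φ y (σ y)) x du
         = Φ x (fderiv ℝ σ x du + s • wedge n (S.F x) (S.W₁ x) (σ x)))
      ∧ (fderiv ℝ (fun y => Φ y (σ y)) x dv
         = Φ x (fderiv ℝ σ x dv + s • wedge n (S.F x) (S.W₂ x) (σ x))))

/-- `(Λ_s, η_s)` is the T-transform of `(Λ,η)` associated to `Φ_s`: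
`Λ_s = Φ_s Λ` and `η_s = Ad(Φ_s) η`. -/
def IsTTransform (n : ℕ) (S : IsothermicSurface n) (s : ℝ)
    (Φ : Surf → MV n → MV n) (Ss : IsothermicSurface n) : Prop :=
  IsTGauge n S s Φ
  ∧ (∀ x, Ss.F x = Φ x (S.F x))
  ∧ (∀ x z, wedge n (Ss.F x) (Ss.W₁ x) (Φ x z) = Φ x (wedge n (S.F x) (S.W₁ x) z))
  ∧ (∀ x z, wedge n (Ss.F x) (Ss.W₂ x) (Φ x z) = Φ x (wedge n (S.F x) (S.W₂ x) z))

/-- orthogonal complement with respect to the Minkowski form -/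
def mperp (n : ℕ) (U : Submodule ℝ (MV n)) : Submodule ℝ (MV n) where
  carrier := {v | ∀ u ∈ U, mink n v u = 0}
  add_mem' := by
    intro a b ha hb u hu
    rw [mink_add_left, ha u hu, hb u hu, add_zero]
  zero_mem' := by
    intro u hu; exact mink_zero_left n u
  smul_mem' := by
    intro r a ha u hu
    rw [mink_smul_left, ha u hu, mul_zero]

/-- the spherical system of `Λ` and a Darboux transform `Λ̂ = ⟨G⟩`: the
`(n−2)`-sphere congruence `C = Λ ⊕ Λ̂ ⊕ V_R^⊥`, `V_R = Λ^{(1)} ⊕ Λ̂`. -/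
def sphericalSystem (n : ℕ) (S : IsothermicSurface n) (G : Surf → MV n)
    (x : Surf) : Submodule ℝ (MV n) :=
  Submodule.span ℝ {S.F x, G x}
    ⊔ mperp n (Submodule.span ℝ {S.F x, pd du S.F x, pd dv S.F x, G x})

/-- the sphere-planes congruence `P = C + ⟨w⟩` of `Λ` and `Λ̂ = ⟨G⟩` with
respect to `w`. -/
def spherePlanes (n : ℕ) (S : IsothermicSurface n) (G : Surf → MV n)
    (w : MV n) (x : Surf) : Submodule ℝ (MV n) :=
  sphericalSystem n S G x ⊔ Submodule.span ℝ {w}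
/-- The central sphere congruence `V_csc = Λ^{(1)} ⊕ ⟨ΔF⟩`: since the
Christoffel-symbol terms of the Laplace–Beltrami operator lie in `Λ^{(1)}`,
`V_csc` is spanned by `F, F_u, F_v` and `g₂₂F_uu − 2g₁₂F_uv + g₁₁F_vv`. -/
def Vcsc (n : ℕ) (S : IsothermicSurface n) (x : Surf) : Submodule ℝ (MV n) :=
  Submodule.span ℝ {S.F x, pd du S.F x, pd dv S.F x,
    gVV n S.F x • pd du (pd du S.F) x - (2 * gUV n S.F x) • pd du (pd dv S.F) x
      + gUU n S.F x • pd dv (pd dv S.F) x}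

/-! ### Calculus of partial derivatives -/

section PartialDerivatives

variable {f g : Surf → ℝ} {x : Surf}

theorem contDiff_pdR (hf : ContDiff ℝ (⊤ : ℕ∞) f) (e : Surf) :
    ContDiff ℝ (⊤ : ℕ∞) (pdR e f) :=
  (hf.fderiv_right (m := (⊤ : ℕ∞)) (by simp)).clm_apply contDiff_const

theorem ContDiff.differentiableAt_of_top {V : Type*} [NormedAddCommGroup V] [NormedSpace ℝ V]
    {h : Surf → V} (hh : ContDiff ℝ (⊤ : ℕ∞) h) (y : Surf) : DifferentiableAt ℝ h y :=
  (hh.differentiable (by simp)) y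

theorem pdR_add (hf : DifferentiableAt ℝ f x) (hg : DifferentiableAt ℝ g x) (e : Surf) :
    pdR e (fun y => f y + g y) x = pdR e f x + pdR e g x := by
  simp [pdR, fderiv_fun_add hf hg]

theorem pdR_sub (hf : DifferentiableAt ℝ f x) (hg : DifferentiableAt ℝ g x) (e : Surf) :
    pdR e (fun y => f y - g y) x = pdR e f x - pdR e g x := by
  simp [pdR, fderiv_fun_sub hf hg]

theorem pdR_mul (hf : DifferentiableAt ℝ f x) (hg : DifferentiableAt ℝ g x) (e : Surf) :
    pdR e (fun y => f y * g y) x = f x * pdR e g x + g x * pdR e f x := by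
  simp [pdR, fderiv_fun_mul hf hg]

theorem pdR_const_mul (hf : DifferentiableAt ℝ f x) (c : ℝ) (e : Surf) :
    pdR e (fun y => c * f y) x = c * pdR e f x := by
  simp [pdR, fderiv_const_mul hf]

theorem pdR_exp (hf : DifferentiableAt ℝ f x) (e : Surf) :
    pdR e (fun y => Real.exp (f y)) x = Real.exp (f x) * pdR e f x := by
  simp [pdR, fderiv_exp hf]

theorem pdR_eq_zero_of_eventuallyEq_const {c : ℝ} (h : f =ᶠ[nhds x] fun _ => c) (e : Surf) :
    pdR e f x = 0 := by
  simp [pdR, h.fderiv_eq]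

theorem HasCompactSupport.pdR (hf : HasCompactSupport f) (e : Surf) :
    HasCompactSupport (pdR e f) :=
  hf.fderiv_apply ℝ e

theorem integral_pdR_eq_zero (hf : ContDiff ℝ (⊤ : ℕ∞) f) (hc : HasCompactSupport f)
    (e : Surf) : ∫ y, pdR e f y = 0 := by
  have hd : HasCompactSupport (pdR e f) := hc.pdR e
  have h := integral_mul_fderiv_eq_neg_fderiv_mul_of_integrable (μ := MeasureTheory.volume)
    (f := fun _ : Surf => (1 : ℝ)) (g := f) (v := e) (by simp)
    (by
      simp only [one_mul]
      exact (contDiff_pdR hf e).continuous.integrable_of_hasCompactSupport hd)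
    (by simpa using hf.continuous.integrable_of_hasCompactSupport hc)
    (fun y _ => differentiableAt_const _) (fun y _ => hf.differentiableAt_of_top y)
  simpa [pdR] using h

end PartialDerivatives

/-! ### A Carleman estimate for planar first order elliptic operators -/

/-- The real part of `(∂_v - (α + iβ) ∂_u)(p + iq)`. -/
def beltramiRe (α β p q : Surf → ℝ) (x : Surf) : ℝ :=
  pdR dv p x - α x * pdR du p x + β x * pdR du q x

/-- The imaginary part of `(∂_v - (α + iβ) ∂_u)(p + iq)`. -/
def beltramiIm (α β p q : Surf → ℝ) (x : Surf) : ℝ :=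
  pdR dv q x - α x * pdR du q x - β x * pdR du p x

/-- The `u`-component of the conformally invariant gradient of `φ`. -/
def fluxU (α β φ : Surf → ℝ) (x : Surf) : ℝ :=
  ((α x ^ 2 + β x ^ 2) * pdR du φ x - α x * pdR dv φ x) / β x

/-- The `v`-component of the conformally invariant gradient of `φ`. -/
def fluxV (α β φ : Surf → ℝ) (x : Surf) : ℝ :=
  (pdR dv φ x - α x * pdR du φ x) / β x

/-- The conformally invariant Laplacian attached to the complex structure defined by
`∂_v - (α + iβ) ∂_u`. -/
def conformalLaplacian (α β φ : Surf → ℝ) (x : Surf) : ℝ :=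
  pdR du (fluxU α β φ) x + pdR dv (fluxV α β φ) x

section Carleman

variable {α β φ p q : Surf → ℝ}

theorem contDiff_fluxU (hα : ContDiff ℝ (⊤ : ℕ∞) α) (hβ : ContDiff ℝ (⊤ : ℕ∞) β)
    (hβ0 : ∀ x, 0 < β x) (hφ : ContDiff ℝ (⊤ : ℕ∞) φ) :
    ContDiff ℝ (⊤ : ℕ∞) (fluxU α β φ) :=
  ((((hα.pow 2).add (hβ.pow 2)).mul (contDiff_pdR hφ du)).sub
    (hα.mul (contDiff_pdR hφ dv))).div hβ fun x => (hβ0 x).ne'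

theorem contDiff_fluxV (hα : ContDiff ℝ (⊤ : ℕ∞) α) (hβ : ContDiff ℝ (⊤ : ℕ∞) β)
    (hβ0 : ∀ x, 0 < β x) (hφ : ContDiff ℝ (⊤ : ℕ∞) φ) :
    ContDiff ℝ (⊤ : ℕ∞) (fluxV α β φ) :=
  ((contDiff_pdR hφ dv).sub (hα.mul (contDiff_pdR hφ du))).div hβ fun x => (hβ0 x).ne'

theorem contDiff_conformalLaplacian (hα : ContDiff ℝ (⊤ : ℕ∞) α) (hβ : ContDiff ℝ (⊤ : ℕ∞) β)
    (hβ0 : ∀ x, 0 < β x) (hφ : ContDiff ℝ (⊤ : ℕ∞) φ) :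
    ContDiff ℝ (⊤ : ℕ∞) (conformalLaplacian α β φ) :=
  (contDiff_pdR (contDiff_fluxU hα hβ hβ0 hφ) du).add
    (contDiff_pdR (contDiff_fluxV hα hβ hβ0 hφ) dv)

theorem contDiff_beltramiRe (hα : ContDiff ℝ (⊤ : ℕ∞) α) (hβ : ContDiff ℝ (⊤ : ℕ∞) β)
    (hp : ContDiff ℝ (⊤ : ℕ∞) p) (hq : ContDiff ℝ (⊤ : ℕ∞) q) :
    ContDiff ℝ (⊤ : ℕ∞) (beltramiRe α β p q) :=
  ((contDiff_pdR hp dv).sub (hα.mul (contDiff_pdR hp du))).add (hβ.mul (contDiff_pdR hq du))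

theorem contDiff_beltramiIm (hα : ContDiff ℝ (⊤ : ℕ∞) α) (hβ : ContDiff ℝ (⊤ : ℕ∞) β)
    (hp : ContDiff ℝ (⊤ : ℕ∞) p) (hq : ContDiff ℝ (⊤ : ℕ∞) q) :
    ContDiff ℝ (⊤ : ℕ∞) (beltramiIm α β p q) :=
  ((contDiff_pdR hq dv).sub (hα.mul (contDiff_pdR hq du))).sub (hβ.mul (contDiff_pdR hp du))

/-- The partial derivatives of a smooth function commute. -/
theorem pdR_comm (hp : ContDiff ℝ (⊤ : ℕ∞) p) (x : Surf) :
    pdR du (pdR dv p) x = pdR dv (pdR du p) x := by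
  have hd : DifferentiableAt ℝ (fderiv ℝ p) x :=
    (hp.fderiv_right (m := (⊤ : ℕ∞)) (by simp)).differentiableAt_of_top x
  have key : ∀ e e' : Surf, pdR e (pdR e' p) x = fderiv ℝ (fderiv ℝ p) x e e' := by
    intro e e'
    change fderiv ℝ (fun y => fderiv ℝ p y e') x e = _
    rw [fderiv_clm_apply hd (differentiableAt_const _)]
    simp
  rw [key, key]
  exact (hp.contDiffAt.isSymmSndFDerivAt (by simp; norm_cast)) du dv

/-- The operator `∂_v - (α + iβ) ∂_u`, conjugated by `exp φ`, dominates the conformal Laplacian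
of `φ`. -/
theorem carleman_estimate (hα : ContDiff ℝ (⊤ : ℕ∞) α) (hβ : ContDiff ℝ (⊤ : ℕ∞) β)
    (hβ0 : ∀ x, 0 < β x) (hφ : ContDiff ℝ (⊤ : ℕ∞) φ)
    (hp : ContDiff ℝ (⊤ : ℕ∞) p) (hq : ContDiff ℝ (⊤ : ℕ∞) q)
    (hpc : HasCompactSupport p) (hqc : HasCompactSupport q) :
    ∫ x, (p x ^ 2 + q x ^ 2) * conformalLaplacian α β φ x ≤
      ∫ x, ((beltramiRe α β p q x
            - ((pdR dv φ x - α x * pdR du φ x) * p x + β x * pdR du φ x * q x)) ^ 2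
          + (beltramiIm α β p q x
            - ((pdR dv φ x - α x * pdR du φ x) * q x - β x * pdR du φ x * p x)) ^ 2) / β x := by
  have hX := contDiff_fluxU hα hβ hβ0 hφ
  have hY := contDiff_fluxV hα hβ hβ0 hφ
  have hK := contDiff_conformalLaplacian hα hβ hβ0 hφ
  have hRe := contDiff_beltramiRe hα hβ hp hq
  have hIm := contDiff_beltramiIm hα hβ hp hq
  have hφu := contDiff_pdR hφ du
  have hφv := contDiff_pdR hφ dv
  have hpu := contDiff_pdR hp du
  have hpv := contDiff_pdR hp dv
  let G₁ : Surf → ℝ := fun x => fluxU α β φ x * (p x * p x + q x * q x) - 2 * (q x * pdR dv p x)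
  let G₂ : Surf → ℝ := fun x => fluxV α β φ x * (p x * p x + q x * q x) + 2 * (q x * pdR du p x)
  have hr : ContDiff ℝ (⊤ : ℕ∞) fun x => p x * p x + q x * q x := (hp.mul hp).add (hq.mul hq)
  have hG₁ : ContDiff ℝ (⊤ : ℕ∞) G₁ := (hX.mul hr).sub (contDiff_const.mul (hq.mul hpv))
  have hG₂ : ContDiff ℝ (⊤ : ℕ∞) G₂ := (hY.mul hr).add (contDiff_const.mul (hq.mul hpu))
  have hrc : HasCompactSupport fun x => p x * p x + q x * q x :=
    (hpc.mul_left (f := p)).add (hqc.mul_left (f := q))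
  have hG₁c : HasCompactSupport G₁ := by
    refine HasCompactSupport.sub (hrc.mul_left (f := fluxU α β φ)) ?_
    exact (hqc.mul_right (f' := pdR dv p)).mul_left (f := fun _ => (2 : ℝ))
  have hG₂c : HasCompactSupport G₂ := by
    refine HasCompactSupport.add (hrc.mul_left (f := fluxV α β φ)) ?_
    exact (hqc.mul_right (f' := pdR du p)).mul_left (f := fun _ => (2 : ℝ))
  have hdG₁ : ∀ x, pdR du G₁ x = fluxU α β φ x * (2 * p x * pdR du p x + 2 * q x * pdR du q x)
      + (p x ^ 2 + q x ^ 2) * pdR du (fluxU α β φ) x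
      - 2 * (q x * pdR du (pdR dv p) x + pdR dv p x * pdR du q x) := by
    intro x
    have d1 := hp.differentiableAt_of_top x
    have d2 := hq.differentiableAt_of_top x
    have d3 := hX.differentiableAt_of_top x
    have d4 := hpv.differentiableAt_of_top x
    simp only [G₁]
    rw [pdR_sub (d3.fun_mul ((d1.fun_mul d1).fun_add (d2.fun_mul d2)))
        ((d2.fun_mul d4).const_mul 2),
      pdR_mul d3 ((d1.fun_mul d1).fun_add (d2.fun_mul d2)), pdR_add (d1.fun_mul d1) (d2.fun_mul d2),
      pdR_mul d1 d1, pdR_mul d2 d2, pdR_const_mul (d2.fun_mul d4), pdR_mul d2 d4]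
    ring
  have hdG₂ : ∀ x, pdR dv G₂ x = fluxV α β φ x * (2 * p x * pdR dv p x + 2 * q x * pdR dv q x)
      + (p x ^ 2 + q x ^ 2) * pdR dv (fluxV α β φ) x
      + 2 * (q x * pdR dv (pdR du p) x + pdR du p x * pdR dv q x) := by
    intro x
    have d1 := hp.differentiableAt_of_top x
    have d2 := hq.differentiableAt_of_top x
    have d3 := hY.differentiableAt_of_top x
    have d4 := hpu.differentiableAt_of_top x
    simp only [G₂]
    rw [pdR_add (d3.fun_mul ((d1.fun_mul d1).fun_add (d2.fun_mul d2)))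
        ((d2.fun_mul d4).const_mul 2),
      pdR_mul d3 ((d1.fun_mul d1).fun_add (d2.fun_mul d2)), pdR_add (d1.fun_mul d1) (d2.fun_mul d2),
      pdR_mul d1 d1, pdR_mul d2 d2, pdR_const_mul (d2.fun_mul d4), pdR_mul d2 d4]
    ring
  let R : Surf → ℝ := fun x =>
    ((beltramiRe α β p q x
        - ((pdR dv φ x - α x * pdR du φ x) * p x + β x * pdR du φ x * q x)) ^ 2
      + (beltramiIm α β p q x
        - ((pdR dv φ x - α x * pdR du φ x) * q x - β x * pdR du φ x * p x)) ^ 2) / β x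
  have hRs : ContDiff ℝ (⊤ : ℕ∞) R := by
    refine ContDiff.div (ContDiff.add (ContDiff.pow ?_ 2) (ContDiff.pow ?_ 2)) hβ
      fun x => (hβ0 x).ne'
    · exact hRe.sub (((hφv.sub (hα.mul hφu)).mul hp).add ((hβ.mul hφu).mul hq))
    · exact hIm.sub (((hφv.sub (hα.mul hφu)).mul hq).sub ((hβ.mul hφu).mul hp))
  have hRc : HasCompactSupport R := by
    refine HasCompactSupport.intro (hpc.union hqc) fun x hx => ?_
    have h1 : x ∉ tsupport p := fun h => hx (Or.inl h)
    have h2 : x ∉ tsupport q := fun h => hx (Or.inr h)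
    have e1 := notMem_tsupport_iff_eventuallyEq.1 h1
    have e2 := notMem_tsupport_iff_eventuallyEq.1 h2
    have z1 := fun e => pdR_eq_zero_of_eventuallyEq_const (c := 0) e1 e
    have z2 := fun e => pdR_eq_zero_of_eventuallyEq_const (c := 0) e2 e
    simp [R, beltramiRe, beltramiIm, z1, z2, image_eq_zero_of_notMem_tsupport h1,
      image_eq_zero_of_notMem_tsupport h2]
  have hRi := hRs.continuous.integrable_of_hasCompactSupport hRc
    (μ := MeasureTheory.volume)
  have hI₁ := (contDiff_pdR hG₁ du).continuous.integrable_of_hasCompactSupport (hG₁c.pdR du)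
    (μ := MeasureTheory.volume)
  have hI₂ := (contDiff_pdR hG₂ dv).continuous.integrable_of_hasCompactSupport (hG₂c.pdR dv)
    (μ := MeasureTheory.volume)
  have hL : MeasureTheory.Integrable fun x =>
      (p x ^ 2 + q x ^ 2) * conformalLaplacian α β φ x := by
    refine Continuous.integrable_of_hasCompactSupport
      (((hp.pow 2).add (hq.pow 2)).mul hK).continuous ?_
    refine HasCompactSupport.mul_right ?_
    simpa only [pow_two] using hrc
  have hmono : ∫ x, (p x ^ 2 + q x ^ 2) * conformalLaplacian α β φ x ≤
      ∫ x, (R x + pdR du G₁ x + pdR dv G₂ x) := by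
    refine MeasureTheory.integral_mono hL ((hRi.add hI₁).add hI₂) fun x => ?_
    have hb := hβ0 x
    have key : R x + pdR du G₁ x + pdR dv G₂ x
        - (p x ^ 2 + q x ^ 2) * conformalLaplacian α β φ x
        = ((pdR dv p x - α x * pdR du p x - β x * pdR du φ x * q x) ^ 2
          + (pdR dv q x - α x * pdR du q x + β x * pdR du φ x * p x) ^ 2
          + (β x * pdR du q x - (pdR dv φ x - α x * pdR du φ x) * p x) ^ 2
          + (β x * pdR du p x + (pdR dv φ x - α x * pdR du φ x) * q x) ^ 2) / β x := by
      rw [hdG₁, hdG₂, pdR_comm hp]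
      simp only [R, conformalLaplacian, beltramiRe, beltramiIm]
      rw [show fluxU α β φ x = ((α x ^ 2 + β x ^ 2) * pdR du φ x - α x * pdR dv φ x) / β x from rfl,
        show fluxV α β φ x = (pdR dv φ x - α x * pdR du φ x) / β x from rfl]
      field_simp
      ring
    have : 0 ≤ R x + pdR du G₁ x + pdR dv G₂ x
        - (p x ^ 2 + q x ^ 2) * conformalLaplacian α β φ x := by
      rw [key]; positivity
    exact sub_nonneg.1 this
  have hsplit : ∫ x, (R x + pdR du G₁ x + pdR dv G₂ x) = ∫ x, R x := by
    rw [MeasureTheory.integral_add (f := fun x => R x + pdR du G₁ x) (hRi.add hI₁) hI₂,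
      MeasureTheory.integral_add hRi hI₁,
      integral_pdR_eq_zero hG₁ hG₁c, integral_pdR_eq_zero hG₂ hG₂c]
    simp
  exact hmono.trans hsplit.le

end Carleman

/-! ### Unique continuation -/

section UniqueContinuation

variable {α β φ p q : Surf → ℝ}

theorem beltramiRe_mul {f : Surf → ℝ} {x : Surf} (hf : DifferentiableAt ℝ f x)
    (hp : DifferentiableAt ℝ p x) (hq : DifferentiableAt ℝ q x) :
    beltramiRe α β (fun y => f y * p y) (fun y => f y * q y) x
      = f x * beltramiRe α β p q x
        + ((pdR dv f x - α x * pdR du f x) * p x + β x * pdR du f x * q x) := by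
  simp only [beltramiRe, pdR_mul hf hp, pdR_mul hf hq]
  ring

theorem beltramiIm_mul {f : Surf → ℝ} {x : Surf} (hf : DifferentiableAt ℝ f x)
    (hp : DifferentiableAt ℝ p x) (hq : DifferentiableAt ℝ q x) :
    beltramiIm α β (fun y => f y * p y) (fun y => f y * q y) x
      = f x * beltramiIm α β p q x
        + ((pdR dv f x - α x * pdR du f x) * q x - β x * pdR du f x * p x) := by
  simp only [beltramiIm, pdR_mul hf hp, pdR_mul hf hq]
  ring

theorem conformalLaplacian_of_gradient_eq {k N : Surf → ℝ}
    (hα : ContDiff ℝ (⊤ : ℕ∞) α) (hβ : ContDiff ℝ (⊤ : ℕ∞) β) (hβ0 : ∀ x, 0 < β x)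
    (hN : ContDiff ℝ (⊤ : ℕ∞) N) (hk : ContDiff ℝ (⊤ : ℕ∞) k)
    (h : ∀ e x, pdR e φ x = k x * pdR e N x) (x : Surf) :
    conformalLaplacian α β φ x = k x * conformalLaplacian α β N x
      + (fluxU α β N x * pdR du k x + fluxV α β N x * pdR dv k x) := by
  have hU : fluxU α β φ = fun y => k y * fluxU α β N y := by
    funext y; simp only [fluxU, h]; ring
  have hV : fluxV α β φ = fun y => k y * fluxV α β N y := by
    funext y; simp only [fluxV, h]; ring
  have dk := hk.differentiableAt_of_top x
  rw [conformalLaplacian, hU, hV,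
    pdR_mul dk ((contDiff_fluxU hα hβ hβ0 hN).differentiableAt_of_top x),
    pdR_mul dk ((contDiff_fluxV hα hβ hβ0 hN).differentiableAt_of_top x), conformalLaplacian]
  ring

/-- The squared Euclidean distance to the point `z`. -/
def sqDist (z x : Surf) : ℝ := (x.1 - z.1) ^ 2 + (x.2 - z.2) ^ 2

theorem contDiff_sqDist (z : Surf) : ContDiff ℝ (⊤ : ℕ∞) (sqDist z) := by
  unfold sqDist; fun_prop

theorem pdR_sqDist (z x : Surf) (e : Surf) :
    pdR e (sqDist z) x = 2 * (x.1 - z.1) * e.1 + 2 * (x.2 - z.2) * e.2 := by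
  have h1 : HasFDerivAt (fun y : Surf => y.1 - z.1) (ContinuousLinearMap.fst ℝ ℝ ℝ) x :=
    hasFDerivAt_fst.sub_const _
  have h2 : HasFDerivAt (fun y : Surf => y.2 - z.2) (ContinuousLinearMap.snd ℝ ℝ ℝ) x :=
    hasFDerivAt_snd.sub_const _
  have h := (h1.pow 2).add (h2.pow 2)
  change fderiv ℝ (sqDist z) x e = _
  have h' : HasFDerivAt (sqDist z) _ x := h
  rw [h'.fderiv]
  simp

theorem isCompact_sqDist_le (z : Surf) (R : ℝ) : IsCompact {x | sqDist z x ≤ R} := by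
  refine Metric.isCompact_of_isClosed_isBounded
    (isClosed_le (contDiff_sqDist z).continuous continuous_const) ?_
  refine (Metric.isBounded_closedBall (x := z) (r := R + 1)).subset fun x hx => ?_
  have hx' : (x.1 - z.1) ^ 2 + (x.2 - z.2) ^ 2 ≤ R := hx
  rw [Metric.mem_closedBall, Prod.dist_eq, Real.dist_eq, Real.dist_eq]
  refine max_le (abs_le_of_sq_le_sq' ?_ ?_ |> abs_le.2) (abs_le_of_sq_le_sq' ?_ ?_ |> abs_le.2)
  all_goals nlinarith [sq_nonneg (x.1 - z.1), sq_nonneg (x.2 - z.2)]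

/-- The Carleman weights `τ (exp (-s |x - z|²) - c)`. -/
def carlemanWeight (z : Surf) (s c τ : ℝ) (x : Surf) : ℝ :=
  τ * (Real.exp (-s * sqDist z x) - c)

theorem contDiff_carlemanWeight (z : Surf) (s c τ : ℝ) :
    ContDiff ℝ (⊤ : ℕ∞) (carlemanWeight z s c τ) :=
  contDiff_const.mul (((contDiff_const.mul (contDiff_sqDist z)).exp).sub contDiff_const)

theorem conformalLaplacian_carlemanWeight
    (hα : ContDiff ℝ (⊤ : ℕ∞) α) (hβ : ContDiff ℝ (⊤ : ℕ∞) β) (hβ0 : ∀ x, 0 < β x)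
    (z : Surf) (s c τ : ℝ) (x : Surf) :
    conformalLaplacian α β (carlemanWeight z s c τ) x =
      τ * s * Real.exp (-s * sqDist z x) *
        (s * (fluxU α β (sqDist z) x * pdR du (sqDist z) x
          + fluxV α β (sqDist z) x * pdR dv (sqDist z) x)
            - conformalLaplacian α β (sqDist z) x) := by
  have hN := contDiff_sqDist z
  have hE : ContDiff ℝ (⊤ : ℕ∞) fun y => Real.exp (-s * sqDist z y) :=
    (contDiff_const.mul hN).exp
  have dE : ∀ e y, pdR e (fun y => Real.exp (-s * sqDist z y)) y
      = Real.exp (-s * sqDist z y) * (-s * pdR e (sqDist z) y) := by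
    intro e y
    have d := hN.differentiableAt_of_top y
    rw [pdR_exp (d.const_mul _), pdR_const_mul d]
  rw [conformalLaplacian_of_gradient_eq (N := sqDist z)
    (k := fun y => -(τ * s) * Real.exp (-s * sqDist z y)) hα hβ hβ0 hN
    (contDiff_const.mul hE) ?_ x]
  · rw [pdR_const_mul (hE.differentiableAt_of_top x), pdR_const_mul (hE.differentiableAt_of_top x),
      dE, dE]
    ring
  · intro e y
    have d := hE.differentiableAt_of_top y
    have : pdR e (carlemanWeight z s c τ) y
        = τ * pdR e (fun y => Real.exp (-s * sqDist z y)) y := by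
      change pdR e (fun y => τ * (Real.exp (-s * sqDist z y) - c)) y = _
      rw [pdR_const_mul (d.sub_const c), pdR_sub d (differentiableAt_const c)]
      simp [pdR]
    rw [this, dE]
    ring

/-- On an annulus the weights are strictly subharmonic, provided `s` is large enough. -/
theorem exists_le_conformalLaplacian_carlemanWeight
    (hα : ContDiff ℝ (⊤ : ℕ∞) α) (hβ : ContDiff ℝ (⊤ : ℕ∞) β) (hβ0 : ∀ x, 0 < β x)
    (z : Surf) {ρ : ℝ} (hρ : 0 < ρ) (R : ℝ) :
    ∃ s κ : ℝ, 0 < s ∧ 0 < κ ∧ ∀ c τ : ℝ, 0 ≤ τ → ∀ x, ρ ≤ sqDist z x → sqDist z x ≤ R →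
      τ * κ ≤ conformalLaplacian α β (carlemanWeight z s c τ) x := by
  have hN := contDiff_sqDist z
  let M : Surf → ℝ := fun x => fluxU α β (sqDist z) x * pdR du (sqDist z) x
    + fluxV α β (sqDist z) x * pdR dv (sqDist z) x
  have hM : ∀ x, ρ ≤ sqDist z x → 0 < M x := by
    intro x hx
    have hb := hβ0 x
    have hx' : 0 < (x.1 - z.1) ^ 2 + (x.2 - z.2) ^ 2 := hρ.trans_le hx
    have hMx : M x = (4 * ((x.2 - z.2) - α x * (x.1 - z.1)) ^ 2
        + 4 * (β x * (x.1 - z.1)) ^ 2) / β x := by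
      simp only [M, fluxU, fluxV, pdR_sqDist, du, dv]
      field_simp
      ring
    rw [hMx]
    refine div_pos ?_ hb
    by_cases h1 : x.1 - z.1 = 0
    · rw [h1] at hx' ⊢
      nlinarith
    · have : 0 < (β x * (x.1 - z.1)) ^ 2 := by positivity
      nlinarith [sq_nonneg ((x.2 - z.2) - α x * (x.1 - z.1))]
  have hMc : Continuous M :=
    (((contDiff_fluxU hα hβ hβ0 hN).mul (contDiff_pdR hN du)).add
      ((contDiff_fluxV hα hβ hβ0 hN).mul (contDiff_pdR hN dv))).continuous
  have hLc := (contDiff_conformalLaplacian hα hβ hβ0 hN).continuous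
  have hA : IsCompact ({x | sqDist z x ≤ R} ∩ {x | ρ ≤ sqDist z x}) :=
    (isCompact_sqDist_le z R).inter_right (isClosed_le continuous_const hN.continuous)
  obtain ⟨C, hC⟩ := hA.exists_bound_of_continuousOn
    (f := fun x => (1 + |conformalLaplacian α β (sqDist z) x|) / M x)
    ((continuous_const.add hLc.abs).continuousOn.div hMc.continuousOn
      fun x hx => (hM x hx.2).ne')
  refine ⟨max C 1, Real.exp (-(max C 1) * R), by positivity, Real.exp_pos _, ?_⟩
  intro c τ hτ x hx hxR
  have hs : 1 ≤ max C 1 := le_max_right _ _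
  have h1 : (1 + |conformalLaplacian α β (sqDist z) x|) / M x ≤ max C 1 :=
    ((le_abs_self _).trans (hC x ⟨hxR, hx⟩)).trans (le_max_left _ _)
  rw [div_le_iff₀ (hM x hx)] at h1
  rw [conformalLaplacian_carlemanWeight hα hβ hβ0]
  have h2 : 1 ≤ max C 1 * M x - conformalLaplacian α β (sqDist z) x := by
    linarith [le_abs_self (conformalLaplacian α β (sqDist z) x)]
  have h3 : Real.exp (-(max C 1) * R) ≤ Real.exp (-(max C 1) * sqDist z x) := by
    rw [Real.exp_le_exp]; nlinarith
  calc τ * Real.exp (-(max C 1) * R) ≤ τ * Real.exp (-(max C 1) * sqDist z x) := by gcongr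
    _ = τ * 1 * Real.exp (-(max C 1) * sqDist z x) * 1 := by ring
    _ ≤ τ * (max C 1) * Real.exp (-(max C 1) * sqDist z x) *
        (max C 1 * M x - conformalLaplacian α β (sqDist z) x) := by gcongr

/-- A smooth radial cutoff function, equal to one where `|x - z|² ≤ R - 1` and vanishing where
`|x - z|² ≥ R`. -/
def radialCutoff (z : Surf) (R : ℝ) (x : Surf) : ℝ := Real.smoothTransition (R - sqDist z x)

theorem contDiff_radialCutoff (z : Surf) (R : ℝ) : ContDiff ℝ (⊤ : ℕ∞) (radialCutoff z R) :=
  Real.smoothTransition.contDiff.comp (contDiff_const.sub (contDiff_sqDist z))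

theorem radialCutoff_eq_one {z : Surf} {R : ℝ} {x : Surf} (h : sqDist z x ≤ R - 1) :
    radialCutoff z R x = 1 :=
  Real.smoothTransition.one_of_one_le (by linarith)

theorem radialCutoff_eq_zero {z : Surf} {R : ℝ} {x : Surf} (h : R ≤ sqDist z x) :
    radialCutoff z R x = 0 :=
  Real.smoothTransition.zero_of_nonpos (by linarith)

theorem hasCompactSupport_radialCutoff (z : Surf) (R : ℝ) :
    HasCompactSupport (radialCutoff z R) :=
  HasCompactSupport.intro (isCompact_sqDist_le z R) fun _ hx =>
    radialCutoff_eq_zero (not_le.1 hx).le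

theorem pdR_radialCutoff_eq_zero {z : Surf} {R : ℝ} {x : Surf} (h : sqDist z x < R - 1)
    (e : Surf) : pdR e (radialCutoff z R) x = 0 := by
  refine pdR_eq_zero_of_eventuallyEq_const (c := 1) ?_ e
  filter_upwards [(isOpen_lt (contDiff_sqDist z).continuous continuous_const).mem_nhds h]
    with y hy using radialCutoff_eq_one (le_of_lt hy)

/-- The conjugated operator, applied to a cut off function: the error coming from the cutoff `χ`
is bounded by a term which does not involve the weight `φ`. -/
theorem conjugated_beltrami_le {χ : Surf → ℝ} {x : Surf} {C : ℝ} (hb : 0 < β x)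
    (dφ : DifferentiableAt ℝ φ x) (dχ : DifferentiableAt ℝ χ x)
    (dp : DifferentiableAt ℝ p x) (dq : DifferentiableAt ℝ q x)
    (h : beltramiRe α β p q x ^ 2 + beltramiIm α β p q x ^ 2 ≤ C * (p x ^ 2 + q x ^ 2))
    (hφχ : Real.exp (φ x) ^ 2
        * ((pdR dv χ x - α x * pdR du χ x) ^ 2 + (β x * pdR du χ x) ^ 2)
      ≤ (pdR dv χ x - α x * pdR du χ x) ^ 2 + (β x * pdR du χ x) ^ 2) :
    ((beltramiRe α β (fun y => Real.exp (φ y) * (χ y * p y))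
          (fun y => Real.exp (φ y) * (χ y * q y)) x
        - ((pdR dv φ x - α x * pdR du φ x) * (Real.exp (φ x) * (χ x * p x))
          + β x * pdR du φ x * (Real.exp (φ x) * (χ x * q x)))) ^ 2
      + (beltramiIm α β (fun y => Real.exp (φ y) * (χ y * p y))
          (fun y => Real.exp (φ y) * (χ y * q y)) x
        - ((pdR dv φ x - α x * pdR du φ x) * (Real.exp (φ x) * (χ x * q x))
          - β x * pdR du φ x * (Real.exp (φ x) * (χ x * p x)))) ^ 2) / β x
      ≤ 2 * C / β x * ((Real.exp (φ x) * (χ x * p x)) ^ 2 + (Real.exp (φ x) * (χ x * q x)) ^ 2)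
        + 2 * (((pdR dv χ x - α x * pdR du χ x) ^ 2 + (β x * pdR du χ x) ^ 2)
          * (p x ^ 2 + q x ^ 2)) / β x := by
  rw [beltramiRe_mul dφ.exp (dχ.fun_mul dp) (dχ.fun_mul dq),
    beltramiIm_mul dφ.exp (dχ.fun_mul dp) (dχ.fun_mul dq), beltramiRe_mul dχ dp dq,
    beltramiIm_mul dχ dp dq, pdR_exp dφ, pdR_exp dφ]
  generalize Real.exp (φ x) = E at *
  generalize beltramiRe α β p q x = r₁ at *
  generalize beltramiIm α β p q x = r₂ at *
  generalize pdR dv χ x - α x * pdR du χ x = A at *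
  generalize β x * pdR du χ x = B at *
  rw [div_mul_eq_mul_div, ← add_div]
  refine div_le_div_of_nonneg_right ?_ hb.le
  have e1 : (E * χ x) ^ 2 * (r₁ ^ 2 + r₂ ^ 2) ≤ (E * χ x) ^ 2 * (C * (p x ^ 2 + q x ^ 2)) := by
    gcongr
  have e2 : E ^ 2 * (A ^ 2 + B ^ 2) * (p x ^ 2 + q x ^ 2)
      ≤ (A ^ 2 + B ^ 2) * (p x ^ 2 + q x ^ 2) := by
    gcongr
  linarith [sq_nonneg (E * (χ x * r₁ - (A * p x + B * q x))),
    sq_nonneg (E * (χ x * r₂ - (A * q x - B * p x)))]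

/-- Unique continuation for solutions of `|(∂_v - (α + iβ) ∂_u)(p + iq)|² ≤ C |p + iq|²`. -/
theorem eq_zero_of_beltrami_le {C : Surf → ℝ}
    (hα : ContDiff ℝ (⊤ : ℕ∞) α) (hβ : ContDiff ℝ (⊤ : ℕ∞) β) (hβ0 : ∀ x, 0 < β x)
    (hp : ContDiff ℝ (⊤ : ℕ∞) p) (hq : ContDiff ℝ (⊤ : ℕ∞) q) (hC : Continuous C)
    (h : ∀ x, beltramiRe α β p q x ^ 2 + beltramiIm α β p q x ^ 2 ≤ C x * (p x ^ 2 + q x ^ 2))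
    {z : Surf} (hz : ∀ᶠ x in nhds z, p x = 0 ∧ q x = 0) (x : Surf) : p x = 0 ∧ q x = 0 := by
  have hNc := (contDiff_sqDist z).continuous
  obtain ⟨ρ, hρ, hρz⟩ : ∃ ρ > 0, ∀ y, sqDist z y < ρ → p y = 0 ∧ q y = 0 := by
    obtain ⟨ε, hε, hball⟩ := Metric.eventually_nhds_iff.1 hz
    refine ⟨ε ^ 2, by positivity, fun y hy => hball ?_⟩
    have hy' : (y.1 - z.1) ^ 2 + (y.2 - z.2) ^ 2 < ε ^ 2 := hy
    rw [Prod.dist_eq, Real.dist_eq, Real.dist_eq]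
    exact max_lt (abs_lt_of_sq_lt_sq (by nlinarith [sq_nonneg (y.2 - z.2)]) hε.le)
      (abs_lt_of_sq_lt_sq (by nlinarith [sq_nonneg (y.1 - z.1)]) hε.le)
  by_contra hx
  have hwx : p x ^ 2 + q x ^ 2 ≠ 0 := by
    intro h0
    exact hx ⟨by nlinarith [sq_nonneg (p x), sq_nonneg (q x)],
      by nlinarith [sq_nonneg (p x), sq_nonneg (q x)]⟩
  set R : ℝ := sqDist z x + 2 with hR
  set χ := radialCutoff z R with hχdef
  have hχ : ContDiff ℝ (⊤ : ℕ∞) χ := contDiff_radialCutoff z R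
  have hχc : HasCompactSupport χ := hasCompactSupport_radialCutoff z R
  obtain ⟨s, κ, hs, hκ, hsub⟩ :=
    exists_le_conformalLaplacian_carlemanWeight hα hβ hβ0 z hρ R
  obtain ⟨C', hC'⟩ := (isCompact_sqDist_le z R).exists_bound_of_continuousOn
    (f := fun y => 2 * C y / β y)
    ((continuous_const.mul hC).div hβ.continuous fun y => (hβ0 y).ne').continuousOn
  have hw : Continuous fun y => p y ^ 2 + q y ^ 2 := ((hp.pow 2).add (hq.pow 2)).continuous
  -- the error term, and a lower bound for the weighted norm
  let H : Surf → ℝ := fun y => 2 * (((pdR dv χ y - α y * pdR du χ y) ^ 2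
    + (β y * pdR du χ y) ^ 2) * (p y ^ 2 + q y ^ 2)) / β y
  let θ : Surf → ℝ := fun y => max 0 (min 1 (R - 1 - sqDist z y)) * (p y ^ 2 + q y ^ 2)
  have hθc : HasCompactSupport θ := by
    refine HasCompactSupport.intro (isCompact_sqDist_le z R) fun y hy => ?_
    have hy' : R < sqDist z y := not_le.1 hy
    have : max 0 (min 1 (R - 1 - sqDist z y)) = 0 :=
      max_eq_left ((min_le_right _ _).trans (by linarith))
    simp only [θ, this, zero_mul]
  have hθ : Continuous θ :=
    (continuous_const.max (continuous_const.min (continuous_const.sub hNc))).mul hw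
  have hI : 0 < ∫ y, θ y := by
    refine hθ.integral_pos_of_hasCompactSupport_nonneg_nonzero (x := x) hθc
      (fun y => mul_nonneg (le_max_left _ _) (by positivity)) ?_
    have : max 0 (min 1 (R - 1 - sqDist z x)) = 1 := by
      rw [show R - 1 - sqDist z x = 1 by rw [hR]; ring]; norm_num
    simp only [θ, this, one_mul]
    exact hwx
  have hHc : HasCompactSupport H := by
    refine HasCompactSupport.intro hχc fun y hy => ?_
    have e := notMem_tsupport_iff_eventuallyEq.1 hy
    have z1 := fun e' => pdR_eq_zero_of_eventuallyEq_const (c := 0) e e'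
    simp [H, z1]
  have hH : Continuous H := by
    have c1 := (contDiff_pdR hχ du).continuous
    have c2 := (contDiff_pdR hχ dv).continuous
    exact (continuous_const.mul ((((c2.sub (hα.continuous.mul c1)).pow 2).add
      ((hβ.continuous.mul c1).pow 2)).mul hw)).div hβ.continuous fun y => (hβ0 y).ne'
  have hHi : MeasureTheory.Integrable H := hH.integrable_of_hasCompactSupport hHc
  -- the Carleman inequality for large `τ`
  have main : ∀ τ : ℝ, 0 ≤ τ → C' ≤ τ * κ → (τ * κ - C') * ∫ y, θ y ≤ ∫ y, H y := by
    intro τ hτ hτC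
    set φ := carlemanWeight z s (Real.exp (-s * (R - 1))) τ with hφdef
    have hφ : ContDiff ℝ (⊤ : ℕ∞) φ := contDiff_carlemanWeight _ _ _ _
    let P : Surf → ℝ := fun y => Real.exp (φ y) * (χ y * p y)
    let Q : Surf → ℝ := fun y => Real.exp (φ y) * (χ y * q y)
    have hP : ContDiff ℝ (⊤ : ℕ∞) P := hφ.exp.mul (hχ.mul hp)
    have hQ : ContDiff ℝ (⊤ : ℕ∞) Q := hφ.exp.mul (hχ.mul hq)
    have hPc : HasCompactSupport P :=
      (hχc.mul_right (f' := p)).mul_left (f := fun y => Real.exp (φ y))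
    have hQc : HasCompactSupport Q :=
      (hχc.mul_right (f' := q)).mul_left (f := fun y => Real.exp (φ y))
    have hrc : HasCompactSupport fun y => P y ^ 2 + Q y ^ 2 := by
      simp only [pow_two]
      exact (hPc.mul_left (f := P)).add (hQc.mul_left (f := Q))
    have hr : Continuous fun y => P y ^ 2 + Q y ^ 2 := ((hP.pow 2).add (hQ.pow 2)).continuous
    have hri : MeasureTheory.Integrable fun y => P y ^ 2 + Q y ^ 2 :=
      hr.integrable_of_hasCompactSupport hrc
    have hPQ : ∀ y, P y ^ 2 + Q y ^ 2 = (Real.exp (φ y) * χ y) ^ 2 * (p y ^ 2 + q y ^ 2) := by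
      intro y; simp only [P, Q]; ring
    have hvanish : ∀ y, ¬ (ρ ≤ sqDist z y ∧ sqDist z y ≤ R) → P y ^ 2 + Q y ^ 2 = 0 := by
      intro y hy
      rw [hPQ]
      rcases lt_or_ge (sqDist z y) ρ with h1 | h1
      · simp [hρz y h1]
      · have : χ y = 0 := radialCutoff_eq_zero (not_le.1 fun h2 => hy ⟨h1, h2⟩).le
        simp [this]
    have hlower : τ * κ * ∫ y, (P y ^ 2 + Q y ^ 2)
        ≤ ∫ y, (P y ^ 2 + Q y ^ 2) * conformalLaplacian α β φ y := by
      rw [← MeasureTheory.integral_const_mul]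
      refine MeasureTheory.integral_mono (hri.const_mul _)
        ((hr.mul (contDiff_conformalLaplacian hα hβ hβ0
          hφ).continuous).integrable_of_hasCompactSupport hrc.mul_right) fun y => ?_
      by_cases hy : ρ ≤ sqDist z y ∧ sqDist z y ≤ R
      · have := hsub (Real.exp (-s * (R - 1))) τ hτ y hy.1 hy.2
        simp only
        rw [mul_comm]
        gcongr
      · simp [hvanish y hy]
    have hcarleman := carleman_estimate hα hβ hβ0 hφ hP hQ hPc hQc
    have hsplit : ∫ y, ((beltramiRe α β P Q y
            - ((pdR dv φ y - α y * pdR du φ y) * P y + β y * pdR du φ y * Q y)) ^ 2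
          + (beltramiIm α β P Q y
            - ((pdR dv φ y - α y * pdR du φ y) * Q y - β y * pdR du φ y * P y)) ^ 2) / β y
        ≤ ∫ y, (C' * (P y ^ 2 + Q y ^ 2) + H y) := by
      refine MeasureTheory.integral_mono_of_nonneg
        (Filter.Eventually.of_forall fun y => ?_) ((hri.const_mul C').add hHi)
        (Filter.Eventually.of_forall fun y => ?_)
      · have := hβ0 y
        simp only [Pi.zero_apply]
        positivity
      · refine (conjugated_beltrami_le (hβ0 y) (hφ.differentiableAt_of_top y)
          (hχ.differentiableAt_of_top y) (hp.differentiableAt_of_top y)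
          (hq.differentiableAt_of_top y) (h y) ?_).trans ?_
        · by_cases hy : sqDist z y < R - 1
          · simp [hχdef, pdR_radialCutoff_eq_zero hy]
          · refine mul_le_of_le_one_left (by positivity) (pow_le_one₀ (Real.exp_pos _).le ?_)
            rw [Real.exp_le_one_iff]
            refine mul_nonpos_of_nonneg_of_nonpos hτ (sub_nonpos.2 ?_)
            rw [Real.exp_le_exp]
            nlinarith
        · refine add_le_add ?_ le_rfl
          by_cases hy : ρ ≤ sqDist z y ∧ sqDist z y ≤ R
          · exact mul_le_mul_of_nonneg_right ((le_abs_self _).trans (hC' y hy.2)) (by positivity)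
          · have := hvanish y hy
            simp only [P, Q] at this ⊢
            simp [this]
    have herror : ∫ y, (C' * (P y ^ 2 + Q y ^ 2) + H y)
        = (C' * ∫ y, (P y ^ 2 + Q y ^ 2)) + ∫ y, H y := by
      rw [MeasureTheory.integral_add (hri.const_mul C') hHi, MeasureTheory.integral_const_mul]
    have hθ_le : ∫ y, θ y ≤ ∫ y, (P y ^ 2 + Q y ^ 2) := by
      refine MeasureTheory.integral_mono (hθ.integrable_of_hasCompactSupport hθc) hri fun y => ?_
      simp only [hPQ, θ]
      rcases le_or_gt (sqDist z y) (R - 1) with hy | hy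
      · have h1 : χ y = 1 := radialCutoff_eq_one hy
        have h2 : 1 ≤ Real.exp (φ y) := by
          rw [Real.one_le_exp_iff]
          refine mul_nonneg hτ (sub_nonneg.2 ?_)
          rw [Real.exp_le_exp]
          nlinarith
        rw [h1, mul_one]
        refine mul_le_mul_of_nonneg_right ?_ (by positivity)
        exact (max_le zero_le_one (min_le_left _ _)).trans (one_le_pow₀ h2)
      · have : max 0 (min 1 (R - 1 - sqDist z y)) = 0 :=
          max_eq_left ((min_le_right _ _).trans (by linarith))
        rw [this, zero_mul]
        positivity
    have habsorb := mul_le_mul_of_nonneg_left hθ_le (sub_nonneg.2 hτC)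
    have hchain := (hlower.trans hcarleman).trans (hsplit.trans herror.le)
    rw [sub_mul, sub_mul] at habsorb
    rw [sub_mul]
    linarith
  set I := ∫ y, θ y
  set J := ∫ y, H y
  have hb := main ((|C'| + |J| / I + 1) / κ) (by positivity) (by
    rw [div_mul_cancel₀ _ hκ.ne']
    have := div_nonneg (abs_nonneg J) hI.le
    linarith [le_abs_self C'])
  rw [div_mul_cancel₀ _ hκ.ne'] at hb
  have h1 : (|J| / I + 1) * I ≤ (|C'| + |J| / I + 1 - C') * I := by
    gcongr
    linarith [le_abs_self C']
  have h2 : (|J| / I + 1) * I = |J| + I := by field_simp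
  linarith [le_abs_self J]

end UniqueContinuation

/-! ### Unique continuation for isothermic data in Euclidean space -/

section Isothermic

variable {n : ℕ}

theorem contDiff_pd {f : Surf → MV n} (hf : ContDiff ℝ (⊤ : ℕ∞) f) (e : Surf) :
    ContDiff ℝ (⊤ : ℕ∞) (pd e f) :=
  (hf.fderiv_right (m := (⊤ : ℕ∞)) (by simp)).clm_apply contDiff_const

theorem pdR_inner {f g : Surf → MV n} {x : Surf} (hf : DifferentiableAt ℝ f x)
    (hg : DifferentiableAt ℝ g x) (e : Surf) :
    pdR e (fun y => inner ℝ (f y) (g y)) x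
      = inner ℝ (f x) (pd e g x) + inner ℝ (pd e f x) (g x) :=
  fderiv_inner_apply ℝ hf hg e

theorem sq_inner_sub_inner_le (a b v w : MV n) :
    (inner ℝ a v - inner ℝ b w) ^ 2 ≤ 2 * (‖a‖ ^ 2 + ‖b‖ ^ 2) * (‖v‖ ^ 2 + ‖w‖ ^ 2) := by
  have h1 := abs_le.1 (abs_real_inner_le_norm a v)
  have h2 := abs_le.1 (abs_real_inner_le_norm b w)
  have h3 : (inner ℝ a v) ^ 2 ≤ (‖a‖ * ‖v‖) ^ 2 := sq_le_sq' h1.1 h1.2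
  have h4 : (inner ℝ b w) ^ 2 ≤ (‖b‖ * ‖w‖) ^ 2 := sq_le_sq' h2.1 h2.2
  nlinarith [sq_nonneg (inner ℝ a v + inner ℝ b w), sq_nonneg (‖a‖ * ‖w‖),
    sq_nonneg (‖b‖ * ‖v‖)]

/-- Vectors `a`, `b` are linearly independent only if their Gram determinant is positive. -/
theorem gram_det_pos {a b : MV n} (h : LinearIndependent ℝ ![a, b]) :
    0 < inner ℝ a a ∧ 0 < inner ℝ a a * inner ℝ b b - inner ℝ a b ^ 2 := by
  have ha : 0 < inner ℝ a a := real_inner_self_pos.2 (h.ne_zero 0)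
  refine ⟨ha, ?_⟩
  have hv : inner ℝ a a • b - inner ℝ a b • a ≠ 0 := by
    intro h0
    have := (LinearIndependent.pair_iff.1 h (-inner ℝ a b) (inner ℝ a a)
      (by rw [← h0, neg_smul]; abel)).2
    exact ha.ne' this
  have h1 := real_inner_self_pos.2 hv
  simp only [inner_sub_left, inner_sub_right, real_inner_smul_left, real_inner_smul_right,
    real_inner_comm b a] at h1
  rw [real_inner_comm a b] at h1
  refine pos_of_mul_pos_right (a := inner ℝ a a) ?_ ha.le
  nlinarith

/-- If `a ∧ w₂ = b ∧ w₁`, then `w₁` and `w₂` lie in the span of `a` and `b`, so that their norms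
are determined by their inner products with `a` and `b`. -/
theorem gram_mul_norm_sq {a b w₁ w₂ : MV n}
    (hD : inner ℝ a a * inner ℝ b b - inner ℝ a b ^ 2 ≠ 0)
    (h : ∀ z : MV n, inner ℝ a z • w₂ - inner ℝ w₂ z • a = inner ℝ b z • w₁ - inner ℝ w₁ z • b) :
    (inner ℝ a a * inner ℝ b b - inner ℝ a b ^ 2) * ‖w₁‖ ^ 2
        = inner ℝ a w₁ ^ 2 * inner ℝ b b - 2 * inner ℝ a w₁ * inner ℝ b w₁ * inner ℝ a b
          + inner ℝ b w₁ ^ 2 * inner ℝ a a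
      ∧ (inner ℝ a a * inner ℝ b b - inner ℝ a b ^ 2) * ‖w₂‖ ^ 2
        = inner ℝ a w₂ ^ 2 * inner ℝ b b - 2 * inner ℝ a w₂ * inner ℝ b w₂ * inner ℝ a b
          + inner ℝ b w₂ ^ 2 * inner ℝ a a := by
  set D := inner ℝ a a * inner ℝ b b - inner ℝ a b ^ 2 with hDdef
  have comm := real_inner_comm a b
  have key : ∀ w : MV n, (∃ c₁ c₂ : ℝ, w = c₁ • a + c₂ • b) →
      D * ‖w‖ ^ 2 = inner ℝ a w ^ 2 * inner ℝ b b - 2 * inner ℝ a w * inner ℝ b w * inner ℝ a b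
          + inner ℝ b w ^ 2 * inner ℝ a a := by
    rintro w ⟨c₁, c₂, rfl⟩
    rw [← real_inner_self_eq_norm_sq]
    simp only [inner_add_left, inner_add_right, real_inner_smul_left, real_inner_smul_right, comm,
      hDdef]
    ring
  constructor
  · apply key
    have := h (D⁻¹ • (inner ℝ a a • b - inner ℝ a b • a))
    have e1 : inner ℝ a (D⁻¹ • (inner ℝ a a • b - inner ℝ a b • a)) = 0 := by
      simp only [inner_sub_right, real_inner_smul_right]; ring
    have e2 : inner ℝ b (D⁻¹ • (inner ℝ a a • b - inner ℝ a b • a)) = 1 := by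
      simp only [inner_sub_right, real_inner_smul_right, comm]
      field_simp
      rw [hDdef]
    rw [e1, e2, zero_smul, one_smul, zero_sub] at this
    exact ⟨_, _, (sub_eq_iff_eq_add.1 this.symm).trans (by rw [← neg_smul])⟩
  · apply key
    have := h (D⁻¹ • (inner ℝ b b • a - inner ℝ a b • b))
    have e1 : inner ℝ b (D⁻¹ • (inner ℝ b b • a - inner ℝ a b • b)) = 0 := by
      simp only [inner_sub_right, real_inner_smul_right, comm]
      ring
    have e2 : inner ℝ a (D⁻¹ • (inner ℝ b b • a - inner ℝ a b • b)) = 1 := by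
      simp only [inner_sub_right, real_inner_smul_right]
      field_simp
      rw [hDdef]; ring
    rw [e1, e2, zero_smul, one_smul, zero_sub] at this
    exact ⟨_, _, (sub_eq_iff_eq_add.1 this).trans (by rw [← neg_smul, add_comm])⟩

/-- A trace-free Codazzi system, written in terms of the complex structure `α + iβ` of the metric,
is a Beltrami equation. -/
theorem beltrami_of_codazzi {α β Q₁₁ Q₁₂ Q₂₂ : Surf → ℝ} {x : Surf}
    (hα : DifferentiableAt ℝ α x) (hβ : DifferentiableAt ℝ β x)
    (h₁₁ : DifferentiableAt ℝ Q₁₁ x) (h₁₂ : DifferentiableAt ℝ Q₁₂ x)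
    (h₂₂ : ∀ y, Q₂₂ y = 2 * (α y * Q₁₂ y) - (α y * α y + β y * β y) * Q₁₁ y) :
    beltramiRe α β (fun y => Q₁₂ y - α y * Q₁₁ y) (fun y => β y * Q₁₁ y) x
        = α x * (pdR du Q₁₂ x - pdR dv Q₁₁ x) - (pdR du Q₂₂ x - pdR dv Q₁₂ x)
          + 2 * pdR du α x * Q₁₂ x
          - (pdR dv α x + α x * pdR du α x + β x * pdR du β x) * Q₁₁ x
      ∧ beltramiIm α β (fun y => Q₁₂ y - α y * Q₁₁ y) (fun y => β y * Q₁₁ y) x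
        = -(β x * (pdR du Q₁₂ x - pdR dv Q₁₁ x))
          + (pdR dv β x - α x * pdR du β x + β x * pdR du α x) * Q₁₁ x := by
  have e : Q₂₂ = fun y => 2 * (α y * Q₁₂ y) - (α y * α y + β y * β y) * Q₁₁ y := funext h₂₂
  have e₁ : ∀ d, pdR d (fun y => Q₁₂ y - α y * Q₁₁ y) x
      = pdR d Q₁₂ x - (α x * pdR d Q₁₁ x + Q₁₁ x * pdR d α x) := fun d => by
    rw [pdR_sub h₁₂ (hα.fun_mul h₁₁), pdR_mul hα h₁₁]
  have e₂ : ∀ d, pdR d Q₂₂ x = 2 * (α x * pdR d Q₁₂ x + Q₁₂ x * pdR d α x)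
      - ((α x * α x + β x * β x) * pdR d Q₁₁ x
        + Q₁₁ x * ((α x * pdR d α x + α x * pdR d α x)
          + (β x * pdR d β x + β x * pdR d β x))) := fun d => by
    rw [e, pdR_sub ((hα.fun_mul h₁₂).const_mul 2)
        (((hα.fun_mul hα).fun_add (hβ.fun_mul hβ)).fun_mul h₁₁),
      pdR_const_mul (hα.fun_mul h₁₂), pdR_mul hα h₁₂,
      pdR_mul ((hα.fun_mul hα).fun_add (hβ.fun_mul hβ)) h₁₁,
      pdR_add (hα.fun_mul hα) (hβ.fun_mul hβ), pdR_mul hα hα, pdR_mul hβ hβ]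
  simp only [beltramiRe, beltramiIm, e₁, e₂, pdR_mul hβ h₁₁]
  constructor <;> ring

/-- Unique continuation for the form `w₁ du + w₂ dv` of an isothermic surface `f` in Euclidean
space. -/
theorem eq_zero_of_isothermic {f w₁ w₂ : Surf → MV n} (hf : ContDiff ℝ (⊤ : ℕ∞) f)
    (hw₁ : ContDiff ℝ (⊤ : ℕ∞) w₁) (hw₂ : ContDiff ℝ (⊤ : ℕ∞) w₂)
    (hlin : ∀ x, LinearIndependent ℝ ![pd du f x, pd dv f x])
    (hwedge : ∀ x z, inner ℝ (pd du f x) z • w₂ x - inner ℝ (w₂ x) z • pd du f x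
      = inner ℝ (pd dv f x) z • w₁ x - inner ℝ (w₁ x) z • pd dv f x)
    (hsymm : ∀ x, inner ℝ (pd du f x) (w₂ x) = inner ℝ (pd dv f x) (w₁ x))
    (hclosed : ∀ x, pd du w₂ x = pd dv w₁ x)
    {z : Surf} (hz : ∀ᶠ x in nhds z, w₁ x = 0 ∧ w₂ x = 0) (x : Surf) : w₁ x = 0 ∧ w₂ x = 0 := by
  have hfu := contDiff_pd hf du
  have hfv := contDiff_pd hf dv
  let g₁₁ : Surf → ℝ := fun y => inner ℝ (pd du f y) (pd du f y)
  let g₁₂ : Surf → ℝ := fun y => inner ℝ (pd du f y) (pd dv f y)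
  let g₂₂ : Surf → ℝ := fun y => inner ℝ (pd dv f y) (pd dv f y)
  have s₁₁ : ContDiff ℝ (⊤ : ℕ∞) g₁₁ := hfu.inner ℝ hfu
  have s₁₂ : ContDiff ℝ (⊤ : ℕ∞) g₁₂ := hfu.inner ℝ hfv
  have s₂₂ : ContDiff ℝ (⊤ : ℕ∞) g₂₂ := hfv.inner ℝ hfv
  have p₁₁ : ∀ y, 0 < g₁₁ y := fun y => (gram_det_pos (hlin y)).1
  have pD : ∀ y, 0 < g₁₁ y * g₂₂ y - g₁₂ y ^ 2 := fun y => (gram_det_pos (hlin y)).2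
  let α : Surf → ℝ := fun y => g₁₂ y / g₁₁ y
  let β : Surf → ℝ := fun y => Real.sqrt (g₁₁ y * g₂₂ y - g₁₂ y ^ 2) / g₁₁ y
  have hα : ContDiff ℝ (⊤ : ℕ∞) α := s₁₂.div s₁₁ fun y => (p₁₁ y).ne'
  have hβ : ContDiff ℝ (⊤ : ℕ∞) β :=
    (((s₁₁.mul s₂₂).sub (s₁₂.pow 2)).sqrt fun y => (pD y).ne').div s₁₁ fun y => (p₁₁ y).ne'
  have hβ0 : ∀ y, 0 < β y := fun y => div_pos (Real.sqrt_pos.2 (pD y)) (p₁₁ y)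
  have e₁₂ : ∀ y, g₁₂ y = α y * g₁₁ y := fun y => (div_mul_cancel₀ _ (p₁₁ y).ne').symm
  have hβsq : ∀ y, (β y * g₁₁ y) ^ 2 = g₁₁ y * g₂₂ y - g₁₂ y ^ 2 := fun y => by
    simp only [β]
    rw [div_mul_cancel₀ _ (p₁₁ y).ne', Real.sq_sqrt (pD y).le]
  have e₂₂ : ∀ y, g₂₂ y = (α y ^ 2 + β y ^ 2) * g₁₁ y := fun y => by
    refine mul_left_cancel₀ (p₁₁ y).ne' ?_
    linear_combination -hβsq y + (g₁₂ y + α y * g₁₁ y) * e₁₂ y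
  let Q₁₁ : Surf → ℝ := fun y => inner ℝ (pd du f y) (w₁ y)
  let Q₁₂ : Surf → ℝ := fun y => inner ℝ (pd du f y) (w₂ y)
  let Q₂₂ : Surf → ℝ := fun y => inner ℝ (pd dv f y) (w₂ y)
  have hQ₁₁ : ContDiff ℝ (⊤ : ℕ∞) Q₁₁ := hfu.inner ℝ hw₁
  have hQ₁₂ : ContDiff ℝ (⊤ : ℕ∞) Q₁₂ := hfu.inner ℝ hw₂
  have hQ₁₂' : Q₁₂ = fun y => inner ℝ (pd dv f y) (w₁ y) := funext hsymm
  have htrace : ∀ y, Q₂₂ y = 2 * (α y * Q₁₂ y) - (α y * α y + β y * β y) * Q₁₁ y := fun y => by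
    have h1 := congrArg (fun v => inner ℝ (pd dv f y) v) (hwedge y (pd du f y))
    simp only [inner_sub_right, real_inner_smul_right] at h1
    rw [real_inner_comm (pd du f y) (pd dv f y), real_inner_comm (pd du f y) (w₁ y),
      real_inner_comm (pd du f y) (w₂ y), ← hsymm y] at h1
    change g₁₁ y * Q₂₂ y - Q₁₂ y * g₁₂ y = g₁₂ y * Q₁₂ y - Q₁₁ y * g₂₂ y at h1
    refine mul_left_cancel₀ (p₁₁ y).ne' ?_
    linear_combination h1 + 2 * Q₁₂ y * e₁₂ y - Q₁₁ y * e₂₂ y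
  let r : Surf → ℝ := fun y => Q₁₂ y - α y * Q₁₁ y
  let s : Surf → ℝ := fun y => β y * Q₁₁ y
  have hnorm : ∀ y, (g₁₁ y * β y ^ 2) * (‖w₁ y‖ ^ 2 + ‖w₂ y‖ ^ 2)
      = (1 + α y ^ 2 + β y ^ 2) * (r y ^ 2 + s y ^ 2) := fun y => by
    obtain ⟨n₁, n₂⟩ := gram_mul_norm_sq (pD y).ne' (hwedge y)
    rw [← hsymm y] at n₁
    change (g₁₁ y * g₂₂ y - g₁₂ y ^ 2) * _
      = Q₁₁ y ^ 2 * g₂₂ y - 2 * Q₁₁ y * Q₁₂ y * g₁₂ y + Q₁₂ y ^ 2 * g₁₁ y at n₁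
    change (g₁₁ y * g₂₂ y - g₁₂ y ^ 2) * _
      = Q₁₂ y ^ 2 * g₂₂ y - 2 * Q₁₂ y * Q₂₂ y * g₁₂ y + Q₂₂ y ^ 2 * g₁₁ y at n₂
    rw [htrace y] at n₂
    rw [← hβsq y, e₂₂ y, e₁₂ y] at n₁ n₂
    refine mul_left_cancel₀ (p₁₁ y).ne' ?_
    simp only [r, s]
    linear_combination n₁ + n₂
  have hzero : ∀ y, r y = 0 → s y = 0 → w₁ y = 0 ∧ w₂ y = 0 := fun y h1 h2 => by
    have h3 := hnorm y
    rw [h1, h2] at h3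
    have h4 : ‖w₁ y‖ ^ 2 + ‖w₂ y‖ ^ 2 = 0 := by
      have : g₁₁ y * β y ^ 2 ≠ 0 := (mul_pos (p₁₁ y) (pow_pos (hβ0 y) 2)).ne'
      refine mul_left_cancel₀ this ?_
      rw [h3]; ring
    rw [add_eq_zero_iff_of_nonneg (by positivity) (by positivity)] at h4
    simpa using h4
  let ν : Surf → ℝ := fun y => (1 + α y ^ 2 + β y ^ 2) / (g₁₁ y * β y ^ 2)
  let K₁ : Surf → ℝ := fun y =>
    2 * (‖pd du (pd du f) y‖ ^ 2 + ‖pd dv (pd du f) y‖ ^ 2) * ν y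
  let K₂ : Surf → ℝ := fun y =>
    2 * (‖pd du (pd dv f) y‖ ^ 2 + ‖pd dv (pd dv f) y‖ ^ 2) * ν y
  have hN : ∀ y, ‖w₁ y‖ ^ 2 + ‖w₂ y‖ ^ 2 = ν y * (r y ^ 2 + s y ^ 2) := fun y => by
    have : g₁₁ y * β y ^ 2 ≠ 0 := (mul_pos (p₁₁ y) (pow_pos (hβ0 y) 2)).ne'
    simp only [ν]
    rw [div_mul_eq_mul_div, ← hnorm y, mul_div_cancel_left₀ _ this]
  have dfu := fun y => hfu.differentiableAt_of_top y
  have dfv := fun y => hfv.differentiableAt_of_top y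
  have dw₁ := fun y => hw₁.differentiableAt_of_top y
  have dw₂ := fun y => hw₂.differentiableAt_of_top y
  have hE₁ : ∀ y, (pdR du Q₁₂ y - pdR dv Q₁₁ y) ^ 2 ≤ K₁ y * (r y ^ 2 + s y ^ 2) := fun y => by
    have : pdR du Q₁₂ y - pdR dv Q₁₁ y
        = inner ℝ (pd du (pd du f) y) (w₂ y) - inner ℝ (pd dv (pd du f) y) (w₁ y) := by
      simp only [Q₁₂, Q₁₁]
      rw [pdR_inner (dfu y) (dw₂ y), pdR_inner (dfu y) (dw₁ y), hclosed y]
      ring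
    rw [this]
    refine (sq_inner_sub_inner_le _ _ _ _).trans_eq ?_
    rw [add_comm (‖w₂ y‖ ^ 2), hN y, mul_assoc, ← mul_assoc, ← mul_assoc]
  have hE₂ : ∀ y, (pdR du Q₂₂ y - pdR dv Q₁₂ y) ^ 2 ≤ K₂ y * (r y ^ 2 + s y ^ 2) := fun y => by
    have : pdR du Q₂₂ y - pdR dv Q₁₂ y
        = inner ℝ (pd du (pd dv f) y) (w₂ y) - inner ℝ (pd dv (pd dv f) y) (w₁ y) := by
      rw [hQ₁₂']
      simp only [Q₂₂]
      rw [pdR_inner (dfv y) (dw₂ y), pdR_inner (dfv y) (dw₁ y), hclosed y]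
      ring
    rw [this]
    refine (sq_inner_sub_inner_le _ _ _ _).trans_eq ?_
    rw [add_comm (‖w₂ y‖ ^ 2), hN y, mul_assoc, ← mul_assoc, ← mul_assoc]
  let k₁ : Surf → ℝ := fun y => pdR dv β y - α y * pdR du β y + β y * pdR du α y
  let k₂ : Surf → ℝ := fun y => pdR dv α y + α y * pdR du α y + β y * pdR du β y
  let C : Surf → ℝ := fun y => 4 * (α y ^ 2 * K₁ y + K₂ y
    + (2 * pdR du α y) ^ 2 * (2 * (1 + α y ^ 2 / β y ^ 2)) + k₂ y ^ 2 / β y ^ 2)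
      + 2 * (β y ^ 2 * K₁ y + k₁ y ^ 2 / β y ^ 2)
  have hC : Continuous C := by
    have ca := hα.continuous
    have cb := hβ.continuous
    have cau := (contDiff_pdR hα du).continuous
    have cav := (contDiff_pdR hα dv).continuous
    have cbu := (contDiff_pdR hβ du).continuous
    have cbv := (contDiff_pdR hβ dv).continuous
    have cg := s₁₁.continuous
    have cuu := (contDiff_pd hfu du).continuous
    have cuv := (contDiff_pd hfu dv).continuous
    have cvu := (contDiff_pd hfv du).continuous
    have cvv := (contDiff_pd hfv dv).continuous
    have hb : ∀ y, β y ^ 2 ≠ 0 := fun y => (pow_pos (hβ0 y) 2).ne'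
    have cν : Continuous ν := Continuous.div (by fun_prop) (by fun_prop)
      fun y => mul_ne_zero (p₁₁ y).ne' (hb y)
    have cK₁ : Continuous K₁ := by fun_prop
    have cK₂ : Continuous K₂ := by fun_prop
    have ck₁ : Continuous k₁ := by fun_prop
    have ck₂ : Continuous k₂ := by fun_prop
    have c₁ : Continuous fun y => α y ^ 2 / β y ^ 2 := (ca.pow 2).div (cb.pow 2) hb
    have c₂ : Continuous fun y => k₁ y ^ 2 / β y ^ 2 := (ck₁.pow 2).div (cb.pow 2) hb
    have c₃ : Continuous fun y => k₂ y ^ 2 / β y ^ 2 := (ck₂.pow 2).div (cb.pow 2) hb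
    fun_prop
  have hle : ∀ y, beltramiRe α β r s y ^ 2 + beltramiIm α β r s y ^ 2
      ≤ C y * (r y ^ 2 + s y ^ 2) := fun y => by
    obtain ⟨hRe, hIm⟩ := beltrami_of_codazzi (hα.differentiableAt_of_top y)
      (hβ.differentiableAt_of_top y) (hQ₁₁.differentiableAt_of_top y)
      (hQ₁₂.differentiableAt_of_top y) htrace
    have hb := hβ0 y
    have q₁₁ : Q₁₁ y ^ 2 ≤ 1 / β y ^ 2 * (r y ^ 2 + s y ^ 2) := by
      have : Q₁₁ y ^ 2 = 1 / β y ^ 2 * s y ^ 2 := by simp only [s]; field_simp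
      rw [this]
      gcongr
      linarith [sq_nonneg (r y)]
    have q₁₂ : Q₁₂ y ^ 2 ≤ 2 * (1 + α y ^ 2 / β y ^ 2) * (r y ^ 2 + s y ^ 2) := by
      have e : Q₁₂ y = r y + α y * Q₁₁ y := by simp only [r]; ring
      have h1 : Q₁₂ y ^ 2 ≤ 2 * (r y ^ 2 + α y ^ 2 * Q₁₁ y ^ 2) := by
        rw [e]; nlinarith [sq_nonneg (r y - α y * Q₁₁ y)]
      have h2 := mul_le_mul_of_nonneg_left q₁₁ (sq_nonneg (α y))
      have h3 : 2 * (1 + α y ^ 2 / β y ^ 2) * (r y ^ 2 + s y ^ 2)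
        = 2 * (r y ^ 2 + s y ^ 2) + 2 * (α y ^ 2 * (1 / β y ^ 2 * (r y ^ 2 + s y ^ 2))) := by ring
      rw [h3]
      linarith [sq_nonneg (s y)]
    have sq4 : ∀ a b c d : ℝ, (a - b + c - d) ^ 2 ≤ 4 * (a ^ 2 + b ^ 2 + c ^ 2 + d ^ 2) :=
      fun a b c d => by
        nlinarith [sq_nonneg (a + b), sq_nonneg (a - c), sq_nonneg (a + d), sq_nonneg (b + c),
          sq_nonneg (b - d), sq_nonneg (c + d)]
    have sq2 : ∀ a b : ℝ, (-a + b) ^ 2 ≤ 2 * (a ^ 2 + b ^ 2) :=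
      fun a b => by nlinarith [sq_nonneg (a + b)]
    have bRe : beltramiRe α β r s y ^ 2 ≤ _ := (congrArg (· ^ 2) hRe).trans_le
      (sq4 (α y * (pdR du Q₁₂ y - pdR dv Q₁₁ y)) (pdR du Q₂₂ y - pdR dv Q₁₂ y)
        (2 * pdR du α y * Q₁₂ y) (k₂ y * Q₁₁ y))
    have bIm : beltramiIm α β r s y ^ 2 ≤ _ := (congrArg (· ^ 2) hIm).trans_le
      (sq2 (β y * (pdR du Q₁₂ y - pdR dv Q₁₁ y)) (k₁ y * Q₁₁ y))
    simp only [mul_pow] at bRe bIm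
    have b₁ := mul_le_mul_of_nonneg_left (hE₁ y) (sq_nonneg (α y))
    have b₂ := mul_le_mul_of_nonneg_left (hE₁ y) (sq_nonneg (β y))
    have b₃ := mul_le_mul_of_nonneg_left q₁₂ (sq_nonneg (2 * pdR du α y))
    have b₄ := mul_le_mul_of_nonneg_left q₁₁ (sq_nonneg (k₁ y))
    have b₅ := mul_le_mul_of_nonneg_left q₁₁ (sq_nonneg (k₂ y))
    have b₆ := hE₂ y
    rw [mul_pow] at b₃
    have hexp : C y * (r y ^ 2 + s y ^ 2)
        = 4 * (α y ^ 2 * (K₁ y * (r y ^ 2 + s y ^ 2)) + K₂ y * (r y ^ 2 + s y ^ 2)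
          + 2 ^ 2 * pdR du α y ^ 2 * (2 * (1 + α y ^ 2 / β y ^ 2) * (r y ^ 2 + s y ^ 2))
          + k₂ y ^ 2 * (1 / β y ^ 2 * (r y ^ 2 + s y ^ 2)))
        + 2 * (β y ^ 2 * (K₁ y * (r y ^ 2 + s y ^ 2))
          + k₁ y ^ 2 * (1 / β y ^ 2 * (r y ^ 2 + s y ^ 2))) := by
      simp only [C]
      ring
    rw [hexp]
    linarith
  refine (fun h => hzero x h.1 h.2) (eq_zero_of_beltrami_le hα hβ hβ0
    (hQ₁₂.sub (hα.mul hQ₁₁)) (hβ.mul hQ₁₁) hC hle (hz.mono fun y hy => ?_) x)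
  simp [Q₁₂, Q₁₁, hy.1, hy.2]

end Isothermic

/-! ### Minkowski space -/

section Minkowski

variable {n : ℕ}

theorem mink_comm (a b : MV n) : mink n a b = mink n b a := by
  simp [mink, mul_comm]

theorem mink_add_right (a b c : MV n) : mink n a (b + c) = mink n a b + mink n a c := by
  rw [mink_comm, mink_add_left, mink_comm b, mink_comm c]

theorem mink_smul_right (r : ℝ) (a c : MV n) : mink n a (r • c) = r * mink n a c := by
  rw [mink_comm, mink_smul_left, mink_comm c]

theorem mink_neg_left (a c : MV n) : mink n (-a) c = -mink n a c := by
  simpa using mink_smul_left n (-1) a c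

theorem mink_neg_right (a c : MV n) : mink n a (-c) = -mink n a c := by
  rw [mink_comm, mink_neg_left, mink_comm c]

theorem mink_sub_left (a b c : MV n) : mink n (a - b) c = mink n a c - mink n b c := by
  rw [sub_eq_add_neg, mink_add_left, mink_neg_left, sub_eq_add_neg]

theorem mink_sub_right (a b c : MV n) : mink n a (b - c) = mink n a b - mink n a c := by
  rw [mink_comm, mink_sub_left, mink_comm b, mink_comm c]

theorem mink_eq_inner (a b : MV n) :
    mink n a b = inner ℝ a b - 2 * (a (Fin.last (n + 1)) * b (Fin.last (n + 1))) := by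
  rw [mink, PiLp.inner_apply, Fin.sum_univ_castSucc (n := n + 1)]
  simp only [RCLike.inner_apply, conj_trivial]
  simp only [mul_comm (b _)]
  ring

/-- The time-like unit vector orthogonal to the space-like coordinate axes. -/
def timeVec (n : ℕ) : MV n := EuclideanSpace.single (Fin.last (n + 1)) 1

theorem mink_timeVec (a : MV n) : mink n a (timeVec n) = -a (Fin.last (n + 1)) := by
  rw [mink_eq_inner, timeVec, EuclideanSpace.inner_single_right]
  simp
  ring

theorem last_ne_zero_of_null {a : MV n} (ha : a ≠ 0) (h : mink n a a = 0) :
    a (Fin.last (n + 1)) ≠ 0 := by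
  intro h0
  rw [mink_eq_inner, h0, mul_zero, mul_zero, sub_zero] at h
  exact ha (inner_self_eq_zero.1 h)

/-- The Minkowski form is positive definite on the orthogonal complement of a null line, modulo
that line. -/
theorem mink_self_pos {a v : MV n} (ha : a ≠ 0) (h : mink n a a = 0) (hv : mink n a v = 0)
    (hne : ∀ c : ℝ, v ≠ c • a) : 0 < mink n v v := by
  have hl := last_ne_zero_of_null ha h
  set c := v (Fin.last (n + 1)) / a (Fin.last (n + 1)) with hc
  have h1 : mink n (v - c • a) (v - c • a) = mink n v v := by
    simp only [mink_sub_left, mink_sub_right, mink_smul_left, mink_smul_right, h, hv,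
      mink_comm v a]
    ring
  have h2 : (v - c • a) (Fin.last (n + 1)) = 0 := by
    simp [hc, div_mul_cancel₀ _ hl]
  rw [← h1, mink_eq_inner, h2, mul_zero, mul_zero, sub_zero]
  exact real_inner_self_pos.2 (sub_ne_zero.2 (hne c))

theorem wedge_smul_self (a z : MV n) (c : ℝ) : wedge n a (c • a) z = 0 := by
  rw [wedge, mink_smul_left, smul_smul, mul_comm, sub_self]

/-- The endomorphism `a ∧ b` as a linear map. -/
def wedgeₗ (a b : MV n) : MV n →ₗ[ℝ] MV n where
  toFun := wedge n a b
  map_add' z z' := by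
    simp only [wedge, mink_add_right, add_smul]; abel
  map_smul' c z := by
    simp only [wedge, mink_smul_right, mul_smul, smul_sub, RingHom.id_apply]

theorem mink_wedge_self (a b z : MV n) : mink n z (wedge n a b z) = 0 := by
  rw [wedge, mink_sub_right, mink_smul_right, mink_smul_right, mink_comm z a, mink_comm z b]
  ring

/-- For null `a` and `b ⊥ a`, the endomorphism `a ∧ b` is determined by its value on `timeVec`. -/
theorem wedge_eq_neg_wedge_timeVec {a b : MV n} (ha : a (Fin.last (n + 1)) ≠ 0) (z : MV n) :
    wedge n a b z
      = -wedge n ((a (Fin.last (n + 1)))⁻¹ • a) (wedge n a b (timeVec n)) z := by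
  simp only [wedge, mink_timeVec, neg_smul, sub_neg_eq_add, mink_add_left, mink_neg_left,
    mink_smul_left, smul_smul]
  match_scalars <;> field_simp
  ring

theorem wedge_eq_zero_of_timeVec {a b : MV n} (ha : a (Fin.last (n + 1)) ≠ 0)
    (h : wedge n a b (timeVec n) = 0) (z : MV n) : wedge n a b z = 0 := by
  rw [wedge_eq_neg_wedge_timeVec ha, h]
  simp [wedge, mink_zero_left]

theorem mink_eq_zero_of_wedge_eq_zero {a b z z' : MV n} (h : wedge n a b z = 0)
    (h' : wedge n a b z' ≠ 0) : mink n a z = 0 := by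
  by_contra h0
  refine h' ?_
  have : b = (mink n b z / mink n a z) • a := by
    rw [wedge, sub_eq_zero] at h
    rw [div_eq_inv_mul, mul_smul, ← h, smul_smul, inv_mul_cancel₀ h0, one_smul]
  rw [this, wedge_smul_self]

theorem pdR_mink {f g : Surf → MV n} {x : Surf} (hf : DifferentiableAt ℝ f x)
    (hg : DifferentiableAt ℝ g x) (e : Surf) :
    pdR e (fun y => mink n (f y) (g y)) x = mink n (f x) (pd e g x) + mink n (pd e f x) (g x) := by
  let π : MV n →L[ℝ] ℝ := EuclideanSpace.proj (Fin.last (n + 1))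
  have hπ : ∀ {h : Surf → MV n}, DifferentiableAt ℝ h x →
      HasFDerivAt (fun y => h y (Fin.last (n + 1))) (π.comp (fderiv ℝ h x)) x :=
    fun hh => π.hasFDerivAt.comp x hh.hasFDerivAt
  have hπ' : ∀ {h : Surf → MV n}, DifferentiableAt ℝ h x →
      pdR e (fun y => h y (Fin.last (n + 1))) x = pd e h x (Fin.last (n + 1)) :=
    fun hh => by rw [pdR, (hπ hh).fderiv]; rfl
  simp only [mink_eq_inner]
  rw [pdR_sub (hf.inner ℝ hg)
      (((hπ hf).differentiableAt.fun_mul (hπ hg).differentiableAt).const_mul 2),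
    pdR_const_mul ((hπ hf).differentiableAt.fun_mul (hπ hg).differentiableAt),
    pdR_mul (hπ hf).differentiableAt (hπ hg).differentiableAt, pdR_inner hf hg, hπ' hf, hπ' hg]
  ring

theorem ContDiff.mink {f g : Surf → MV n} (hf : ContDiff ℝ (⊤ : ℕ∞) f)
    (hg : ContDiff ℝ (⊤ : ℕ∞) g) : ContDiff ℝ (⊤ : ℕ∞) fun y => mink n (f y) (g y) := by
  let π : MV n →L[ℝ] ℝ := EuclideanSpace.proj (Fin.last (n + 1))
  simp only [mink_eq_inner]
  exact (hf.inner ℝ hg).sub (contDiff_const.mul ((π.contDiff.comp hf).mul (π.contDiff.comp hg)))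

theorem pd_smul {c : Surf → ℝ} {f : Surf → MV n} {x : Surf} (hc : DifferentiableAt ℝ c x)
    (hf : DifferentiableAt ℝ f x) (e : Surf) :
    pd e (fun y => c y • f y) x = c x • pd e f x + pdR e c x • f x := by
  simp [pd, pdR, fderiv_fun_smul hc hf]

theorem ContDiff.wedge {f w : Surf → MV n} (hf : ContDiff ℝ (⊤ : ℕ∞) f)
    (hw : ContDiff ℝ (⊤ : ℕ∞) w) (z : MV n) :
    ContDiff ℝ (⊤ : ℕ∞) fun y => wedge n (f y) (w y) z :=
  ((hf.mink contDiff_const).smul hw).sub ((hw.mink contDiff_const).smul hf)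

theorem pd_wedge {f w : Surf → MV n} (hf : ContDiff ℝ (⊤ : ℕ∞) f)
    (hw : ContDiff ℝ (⊤ : ℕ∞) w) (z : MV n) (e x : Surf) :
    pd e (fun y => wedge n (f y) (w y) z) x
      = wedge n (f x) (pd e w x) z + wedge n (pd e f x) (w x) z := by
  have df := hf.differentiableAt_of_top x
  have dw := hw.differentiableAt_of_top x
  have dfz := (hf.mink (contDiff_const (c := z))).differentiableAt_of_top x
  have dwz := (hw.mink (contDiff_const (c := z))).differentiableAt_of_top x
  have h0 : pd e (fun _ : Surf => z) x = 0 := by simp [pd]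
  have h1 : pd e (fun y => wedge n (f y) (w y) z) x
      = pd e (fun y => mink n (f y) z • w y) x - pd e (fun y => mink n (w y) z • f y) x := by
    simp only [wedge, pd]
    rw [fderiv_fun_sub (dfz.fun_smul dw) (dwz.fun_smul df)]
    rfl
  rw [h1, pd_smul dfz dw, pd_smul dwz df, pdR_mink df (differentiableAt_const z),
    pdR_mink dw (differentiableAt_const z), h0]
  simp only [wedge, mink_comm _ (0 : MV n), mink_zero_left, zero_add]
  abel

/-- The differential of a function whose inner product with another one vanishes. -/
theorem mink_pd_eq_neg {f g : Surf → MV n} (hf : ContDiff ℝ (⊤ : ℕ∞) f)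
    (hg : ContDiff ℝ (⊤ : ℕ∞) g) (h : ∀ x, mink n (f x) (g x) = 0) (e x : Surf) :
    mink n (pd e f x) (g x) = -mink n (f x) (pd e g x) := by
  have h1 := pdR_mink (hf.differentiableAt_of_top x) (hg.differentiableAt_of_top x) e
  rw [show (fun y => mink n (f y) (g y)) = fun _ => 0 from funext h] at h1
  have h2 : pdR e (fun _ : Surf => (0 : ℝ)) x = 0 := by simp [pdR]
  linarith

theorem pd_last {f : Surf → MV n} (hf : ContDiff ℝ (⊤ : ℕ∞) f) {c : ℝ}
    (h : ∀ x, f x (Fin.last (n + 1)) = c) (e x : Surf) : pd e f x (Fin.last (n + 1)) = 0 := by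
  have h1 := pdR_mink (hf.differentiableAt_of_top x) (differentiableAt_const (timeVec n)) e
  have h0 : pd e (fun _ : Surf => timeVec n) x = 0 := by simp [pd]
  simp only [mink_timeVec, h, h0, mink_comm _ (0 : MV n), mink_zero_left] at h1
  have h2 : pdR e (fun _ : Surf => -c) x = 0 := by simp [pdR]
  linarith

end Minkowski

/-! ### Isothermic surfaces -/

namespace IsothermicSurface

variable {n : ℕ} (S : IsothermicSurface n)

theorem mink_F_pd (e x : Surf) : mink n (S.F x) (pd e S.F x) = 0 := by
  have h := mink_pd_eq_neg S.smooth_F S.smooth_F S.F_null e x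
  rw [mink_comm] at h
  linarith

theorem wedge_pd_eq (x : Surf) (z : MV n) :
    wedge n (S.F x) (pd du S.W₂ x) z + wedge n (pd du S.F x) (S.W₂ x) z
      = wedge n (S.F x) (pd dv S.W₁ x) z + wedge n (pd dv S.F x) (S.W₁ x) z := by
  rw [← pd_wedge S.smooth_F S.smooth_W₂, ← pd_wedge S.smooth_F S.smooth_W₁]
  exact S.eta_closed x z

/-- The quadratic form of an isothermic surface is symmetric. -/
theorem mink_pd_symm (x : Surf) :
    mink n (pd du S.F x) (S.W₂ x) = mink n (pd dv S.F x) (S.W₁ x) := by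
  have h := S.wedge_pd_eq x (S.F x)
  simp only [wedge, S.F_null x, mink_comm (pd _ S.F x) (S.F x), mink_F_pd, mink_comm _ (S.F x),
    S.W₁_perp x, S.W₂_perp x, zero_smul, zero_sub, sub_zero, add_zero, neg_inj] at h
  have h1 := smul_left_injective ℝ (S.F_ne x) h
  rw [mink_pd_eq_neg S.smooth_F S.smooth_W₂ S.W₂_perp, mink_pd_eq_neg S.smooth_F S.smooth_W₁
    S.W₁_perp]
  simpa using h1

/-- The quadratic form of an isothermic surface is trace-free. -/
theorem trace_eq_zero (x : Surf) :
    gVV n S.F x * mink n (pd du S.F x) (S.W₁ x)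
      - 2 * gUV n S.F x * mink n (pd dv S.F x) (S.W₁ x)
      + gUU n S.F x * mink n (pd dv S.F x) (S.W₂ x) = 0 := by
  have h := congrArg (mink n (pd dv S.F x)) (S.wedge_pd_eq x (pd du S.F x))
  simp only [wedge, mink_add_right, mink_sub_right, mink_smul_right,
    mink_comm (pd _ S.F x) (S.F x), mink_F_pd, mink_comm (S.W₁ x), mink_comm (S.W₂ x),
    S.mink_pd_symm x, mink_comm (pd dv S.F x) (pd du S.F x)] at h
  simp only [gUU, gUV, gVV]
  linarith

theorem gram_pos (x : Surf) :
    0 < gUU n S.F x ∧ 0 < gUU n S.F x * gVV n S.F x - gUV n S.F x ^ 2 := by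
  have hlin := S.immersed x
  have hlin' : ∀ a b c : ℝ, a • S.F x + b • pd du S.F x + c • pd dv S.F x = 0 →
      a = 0 ∧ b = 0 ∧ c = 0 := fun a b c h => by
    have := Fintype.linearIndependent_iff.1 hlin ![a, b, c]
      (by simpa [Fin.sum_univ_three] using h)
    exact ⟨this 0, this 1, this 2⟩
  have h1 : 0 < gUU n S.F x := by
    refine mink_self_pos (S.F_ne x) (S.F_null x) (S.mink_F_pd du x) fun c hc => ?_
    have := (hlin' (-c) 1 0 (by rw [hc]; module)).2.1
    exact one_ne_zero this
  refine ⟨h1, ?_⟩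
  have h2 : 0 < mink n (gUU n S.F x • pd dv S.F x - gUV n S.F x • pd du S.F x)
      (gUU n S.F x • pd dv S.F x - gUV n S.F x • pd du S.F x) := by
    refine mink_self_pos (S.F_ne x) (S.F_null x) ?_ fun c hc => ?_
    · simp [mink_sub_right, mink_smul_right, mink_F_pd]
    · have := (hlin' (-c) (-gUV n S.F x) (gUU n S.F x) (by rw [neg_smul, ← hc]; module)).2.2
      exact h1.ne' this
  simp only [mink_sub_left, mink_sub_right, mink_smul_left, mink_smul_right,
    mink_comm (pd dv S.F x) (pd du S.F x)] at h2
  refine pos_of_mul_pos_right (a := gUU n S.F x) ?_ h1.le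
  simp only [gUU, gUV, gVV] at h2 ⊢
  nlinarith

/-- The form `η` of an isothermic surface takes values in `Λ ∧ Λ^{(1)}`. -/
theorem W_mem_span (x : Surf) :
    S.W₁ x ∈ Submodule.span ℝ {S.F x, pd du S.F x, pd dv S.F x} ∧
      S.W₂ x ∈ Submodule.span ℝ {S.F x, pd du S.F x, pd dv S.F x} := by
  have hD := (S.gram_pos x).2.ne'
  set D := gUU n S.F x * gVV n S.F x - gUV n S.F x ^ 2 with hDdef
  have hF : S.F x ∈ Submodule.span ℝ {S.F x, pd du S.F x, pd dv S.F x} :=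
    Submodule.subset_span (by simp)
  have hu : pd du S.F x ∈ Submodule.span ℝ {S.F x, pd du S.F x, pd dv S.F x} :=
    Submodule.subset_span (by simp)
  have hv : pd dv S.F x ∈ Submodule.span ℝ {S.F x, pd du S.F x, pd dv S.F x} :=
    Submodule.subset_span (by simp)
  have aux : ∀ z : MV n, mink n (S.F x) z = 0 →
      mink n (pd du S.F x) z • S.W₂ x - mink n (pd dv S.F x) z • S.W₁ x
        ∈ Submodule.span ℝ {S.F x, pd du S.F x, pd dv S.F x} := fun z hz => by
    have h := S.wedge_pd_eq x z
    simp only [wedge, hz, zero_smul, zero_sub] at h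
    have : mink n (pd du S.F x) z • S.W₂ x - mink n (pd dv S.F x) z • S.W₁ x
        = (mink n (pd du S.W₂ x) z - mink n (pd dv S.W₁ x) z) • S.F x
          + mink n (S.W₂ x) z • pd du S.F x - mink n (S.W₁ x) z • pd dv S.F x := by
      rw [sub_smul, ← sub_eq_zero]
      rw [← sub_eq_zero] at h
      rw [← h]
      abel
    rw [this]
    exact sub_mem (add_mem (Submodule.smul_mem _ _ hF) (Submodule.smul_mem _ _ hu))
      (Submodule.smul_mem _ _ hv)
  have comm := mink_comm (pd dv S.F x) (pd du S.F x)
  constructor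
  · have h := aux (D⁻¹ • (gUV n S.F x • pd du S.F x - gUU n S.F x • pd dv S.F x))
      (by simp [mink_sub_right, mink_smul_right, mink_F_pd])
    have e1 : mink n (pd du S.F x)
        (D⁻¹ • (gUV n S.F x • pd du S.F x - gUU n S.F x • pd dv S.F x)) = 0 := by
      simp only [mink_sub_right, mink_smul_right, gUU, gUV]
      ring
    have e2 : mink n (pd dv S.F x)
        (D⁻¹ • (gUV n S.F x • pd du S.F x - gUU n S.F x • pd dv S.F x)) = -1 := by
      simp only [mink_sub_right, mink_smul_right, comm]
      rw [← gUV, ← gVV]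
      field_simp
      rw [hDdef]; ring
    rw [e1, e2] at h
    simpa using h
  · have h := aux (D⁻¹ • (gVV n S.F x • pd du S.F x - gUV n S.F x • pd dv S.F x))
      (by simp [mink_sub_right, mink_smul_right, mink_F_pd])
    have e1 : mink n (pd dv S.F x)
        (D⁻¹ • (gVV n S.F x • pd du S.F x - gUV n S.F x • pd dv S.F x)) = 0 := by
      simp only [mink_sub_right, mink_smul_right, comm, gVV, gUV]
      ring
    have e2 : mink n (pd du S.F x)
        (D⁻¹ • (gVV n S.F x • pd du S.F x - gUV n S.F x • pd dv S.F x)) = 1 := by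
      simp only [mink_sub_right, mink_smul_right]
      rw [← gUU, ← gUV]
      field_simp
      rw [hDdef]; ring
    rw [e1, e2] at h
    simpa using h

theorem last_ne_zero (x : Surf) : S.F x (Fin.last (n + 1)) ≠ 0 :=
  last_ne_zero_of_null (S.F_ne x) (S.F_null x)

/-- The lift of an isothermic surface with time coordinate `1`. -/
def normalizedLift (x : Surf) : MV n := (S.F x (Fin.last (n + 1)))⁻¹ • S.F x

theorem contDiff_inv_last :
    ContDiff ℝ (⊤ : ℕ∞) fun x => (S.F x (Fin.last (n + 1)))⁻¹ := by
  let π : MV n →L[ℝ] ℝ := EuclideanSpace.proj (Fin.last (n + 1))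
  exact (π.contDiff.comp S.smooth_F).inv S.last_ne_zero

theorem contDiff_normalizedLift : ContDiff ℝ (⊤ : ℕ∞) S.normalizedLift :=
  S.contDiff_inv_last.smul S.smooth_F

theorem linearIndependent_pd_normalizedLift (x : Surf) :
    LinearIndependent ℝ ![pd du S.normalizedLift x, pd dv S.normalizedLift x] := by
  have e : ∀ d, pd d S.normalizedLift x = (S.F x (Fin.last (n + 1)))⁻¹ • pd d S.F x
      + pdR d (fun x => (S.F x (Fin.last (n + 1)))⁻¹) x • S.F x := fun d =>
    pd_smul (S.contDiff_inv_last.differentiableAt_of_top x) (S.smooth_F.differentiableAt_of_top x) d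
  refine LinearIndependent.pair_iff.2 fun a b h => ?_
  rw [e, e] at h
  have h3 := Fintype.linearIndependent_iff.1 (S.immersed x)
    ![a * pdR du (fun x => (S.F x (Fin.last (n + 1)))⁻¹) x
      + b * pdR dv (fun x => (S.F x (Fin.last (n + 1)))⁻¹) x,
      a * (S.F x (Fin.last (n + 1)))⁻¹, b * (S.F x (Fin.last (n + 1)))⁻¹] (by
        simp only [Fin.sum_univ_three, Matrix.cons_val]
        rw [← h]
        module)
  have hl := inv_ne_zero (S.last_ne_zero x)
  exact ⟨(mul_eq_zero.1 (h3 1)).resolve_right hl, (mul_eq_zero.1 (h3 2)).resolve_right hl⟩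

/-- The form `η` of an isothermic surface does not vanish on any nonempty open set. -/
theorem frequently_eta_ne (z : Surf) :
    ∃ᶠ x in nhds z, wedge n (S.F x) (S.W₁ x) (timeVec n) ≠ 0
      ∨ wedge n (S.F x) (S.W₂ x) (timeVec n) ≠ 0 := by
  intro hz
  let w₁ : Surf → MV n := fun x => wedge n (S.F x) (S.W₁ x) (timeVec n)
  let w₂ : Surf → MV n := fun x => wedge n (S.F x) (S.W₂ x) (timeVec n)
  have hw₁ : ContDiff ℝ (⊤ : ℕ∞) w₁ := S.smooth_F.wedge S.smooth_W₁ _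
  have hw₂ : ContDiff ℝ (⊤ : ℕ∞) w₂ := S.smooth_F.wedge S.smooth_W₂ _
  have hf := S.contDiff_normalizedLift
  have hclosed : ∀ x, pd du w₂ x = pd dv w₁ x := fun x => S.eta_closed x _
  have lw : ∀ W : MV n, ∀ x, wedge n (S.F x) W (timeVec n) (Fin.last (n + 1)) = 0 := fun W x => by
    simp [wedge, mink_timeVec, mul_comm]
  have lf : ∀ e x, pd e S.normalizedLift x (Fin.last (n + 1)) = 0 := fun e =>
    pd_last hf (c := 1) (fun x => by simp [normalizedLift, S.last_ne_zero x]) e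
  have pw : ∀ W : Surf → MV n, (∀ x, mink n (S.F x) (W x) = 0) →
      ∀ x, mink n (S.normalizedLift x) (wedge n (S.F x) (W x) (timeVec n)) = 0 := fun W hW x => by
    simp [normalizedLift, wedge, mink_smul_left, mink_sub_right, mink_smul_right, hW x, S.F_null x]
  have hsymm : ∀ x, mink n (pd du S.normalizedLift x) (w₂ x)
      = mink n (pd dv S.normalizedLift x) (w₁ x) := fun x => by
    rw [mink_pd_eq_neg hf hw₂ (pw _ S.W₂_perp), mink_pd_eq_neg hf hw₁ (pw _ S.W₁_perp), hclosed x]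
  have hwedge : ∀ x z, wedge n (pd du S.normalizedLift x) (w₂ x) z
      = wedge n (pd dv S.normalizedLift x) (w₁ x) z := fun x z => by
    have h := S.eta_closed x z
    have e : ∀ W : Surf → MV n, (fun y => wedge n (S.F y) (W y) z) = fun y =>
        -wedge n (S.normalizedLift y) (wedge n (S.F y) (W y) (timeVec n)) z := fun W =>
      funext fun y => wedge_eq_neg_wedge_timeVec (S.last_ne_zero y) z
    rw [e, e, fderiv_fun_neg, fderiv_fun_neg] at h
    have h' : pd du (fun y => wedge n (S.normalizedLift y) (w₂ y) z) x
        = pd dv (fun y => wedge n (S.normalizedLift y) (w₁ y) z) x := by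
      simpa [pd] using h
    rw [pd_wedge hf hw₂, pd_wedge hf hw₁, hclosed x] at h'
    exact add_left_cancel h'
  have inner_eq : ∀ {a b : MV n}, a (Fin.last (n + 1)) = 0 → mink n a b = inner ℝ a b :=
    fun h => by rw [mink_eq_inner, h]; ring
  obtain ⟨x, z', hne⟩ := S.eta_ne
  have h0 := eq_zero_of_isothermic hf hw₁ hw₂ S.linearIndependent_pd_normalizedLift
    (fun x z => by
      have := hwedge x z
      simp only [wedge] at this
      rwa [inner_eq (lf _ _), inner_eq (lf _ _), inner_eq (lw _ _), inner_eq (lw _ _)] at this)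
    (fun x => by rw [← inner_eq (lf _ _), ← inner_eq (lf _ _), hsymm x]) hclosed
    (hz.mono fun y hy => by simpa only [not_or, not_not] using hy) x
  rcases hne with h | h
  · exact h (wedge_eq_zero_of_timeVec (S.last_ne_zero x) h0.1 z')
  · exact h (wedge_eq_zero_of_timeVec (S.last_ne_zero x) h0.2 z')

end IsothermicSurface

/-! ### Polynomial conserved quantities -/

theorem eq_zero_of_forall_sum_pow_smul_eq_zero {n m : ℕ} {c : ℕ → MV n}
    (h : ∀ t : ℝ, ∑ k ∈ Finset.range m, t ^ k • c k = 0) {k : ℕ} (hk : k < m) : c k = 0 := by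
  ext i
  let P : Polynomial ℝ := ∑ j ∈ Finset.range m, Polynomial.monomial j (c j i)
  have hP : P = 0 := Polynomial.funext fun t => by
    have := congrArg (fun v : MV n => v i) (h t)
    simp only [WithLp.ofLp_sum, Finset.sum_apply, PiLp.smul_apply, smul_eq_mul,
      PiLp.zero_apply] at this
    simp only [P, Polynomial.eval_finsetSum, Polynomial.eval_monomial, Polynomial.eval_zero]
    rw [← this]
    exact Finset.sum_congr rfl fun j _ => mul_comm _ _
  have := congrArg (fun Q : Polynomial ℝ => Q.coeff k) hP
  simpa [P, Polynomial.finsetSum_coeff, Polynomial.coeff_monomial, hk] using this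

/-- The coefficients of `P' + tLP = 0` for a polynomial `P` of degree `d`. -/
theorem coeff_recursion {n d : ℕ} {P dP : ℕ → MV n} (L : MV n →ₗ[ℝ] MV n) (hd : dP (d + 1) = 0)
    (h : ∀ t : ℝ, ∑ k ∈ Finset.range (d + 1), t ^ k • dP k
      + t • L (∑ k ∈ Finset.range (d + 1), t ^ k • P k) = 0) :
    dP 0 = 0 ∧ ∀ k ≤ d, dP (k + 1) = -L (P k) := by
  let c : ℕ → MV n := fun k => Nat.casesOn k (dP 0) fun j => dP (j + 1) + L (P j)
  have hc : ∀ t : ℝ, ∑ k ∈ Finset.range (d + 2), t ^ k • c k = 0 := fun t => by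
    have h1 : ∑ k ∈ Finset.range (d + 2), t ^ k • dP k
        = ∑ k ∈ Finset.range (d + 1), t ^ k • dP k := by
      rw [Finset.sum_range_succ, hd, smul_zero, add_zero]
    rw [← h t, ← h1, Finset.sum_range_succ' (fun k => t ^ k • c k),
      Finset.sum_range_succ' (fun k => t ^ k • dP k), map_sum, Finset.smul_sum, add_right_comm,
      ← Finset.sum_add_distrib]
    simp only [c, map_smul, smul_add, smul_smul, pow_succ']
    rfl
  refine ⟨eq_zero_of_forall_sum_pow_smul_eq_zero hc (Nat.succ_pos _), fun k hk => ?_⟩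
  exact eq_neg_of_add_eq_zero_left
    (eq_zero_of_forall_sum_pow_smul_eq_zero hc (k := k + 1) (by omega))

theorem eq_of_map_du_dv {V : Type*} [NormedAddCommGroup V] [NormedSpace ℝ V]
    (L : Surf →L[ℝ] V) (e : Surf) : L e = e.1 • L du + e.2 • L dv := by
  rw [← map_smul, ← map_smul, ← map_add]
  congr 1
  ext <;> simp [du, dv]

theorem const_of_fderiv_du_dv {V : Type*} [NormedAddCommGroup V] [NormedSpace ℝ V]
    {f : Surf → V} (hf : ContDiff ℝ (⊤ : ℕ∞) f)
    (h : ∀ x, fderiv ℝ f x du = 0 ∧ fderiv ℝ f x dv = 0) (x y : Surf) : f x = f y :=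
  is_const_of_fderiv_eq_zero (hf.differentiable (by simp)) (fun x => by
    refine ContinuousLinearMap.ext fun e => ?_
    rw [eq_of_map_du_dv, (h x).1, (h x).2]
    simp) x y

namespace PolyConservedQuantity

variable {n d : ℕ} {S : IsothermicSurface n} (p : PolyConservedQuantity n S d)

theorem contDiff_pcEval (t : ℝ) : ContDiff ℝ (⊤ : ℕ∞) (pcEval p t) :=
  ContDiff.sum fun k _ => (p.smooth k).const_smul (t ^ k)

theorem pd_pcEval (t : ℝ) (e x : Surf) :
    pd e (pcEval p t) x = ∑ k ∈ Finset.range (d + 1), t ^ k • pd e (p.coeff k) x := by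
  have hk : ∀ k ∈ Finset.range (d + 1), DifferentiableAt ℝ (fun y => t ^ k • p.coeff k y) x :=
    fun k _ => ((p.smooth k).differentiableAt_of_top x).fun_const_smul _
  have : pcEval p t = fun y => ∑ k ∈ Finset.range (d + 1), t ^ k • p.coeff k y := rfl
  rw [this, pd, fderiv_fun_sum hk, _root_.sum_apply]
  refine Finset.sum_congr rfl fun k _ => ?_
  rw [fderiv_fun_const_smul ((p.smooth k).differentiableAt_of_top x)]
  rfl

theorem pd_coeff (x : Surf) :
    (pd du (p.coeff 0) x = 0 ∧
        ∀ k ≤ d, pd du (p.coeff (k + 1)) x = -wedge n (S.F x) (S.W₁ x) (p.coeff k x)) ∧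
      (pd dv (p.coeff 0) x = 0 ∧
        ∀ k ≤ d, pd dv (p.coeff (k + 1)) x = -wedge n (S.F x) (S.W₂ x) (p.coeff k x)) := by
  have h0 : ∀ e, pd e (p.coeff (d + 1)) x = 0 := fun e => by
    rw [p.coeff_eq_zero (d + 1) (Nat.lt_succ_self d)]
    simp [pd]
  refine ⟨coeff_recursion (P := fun k => p.coeff k x)
    (dP := fun k => pd du (p.coeff k) x) (wedgeₗ (S.F x) (S.W₁ x)) (h0 du) fun t => ?_,
    coeff_recursion (P := fun k => p.coeff k x)
    (dP := fun k => pd dv (p.coeff k) x) (wedgeₗ (S.F x) (S.W₂ x)) (h0 dv) fun t => ?_⟩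
  · rw [← p.pd_pcEval]
    exact (p.conserved t x).1
  · rw [← p.pd_pcEval]
    exact (p.conserved t x).2

theorem mink_pcEval_const (t : ℝ) (x y : Surf) :
    mink n (pcEval p t x) (pcEval p t x) = mink n (pcEval p t y) (pcEval p t y) := by
  have hs := p.contDiff_pcEval t
  have aux : ∀ {W : MV n} {e x : Surf}, fderiv ℝ (pcEval p t) x e
      + t • wedge n (S.F x) W (pcEval p t x) = 0 →
      pdR e (fun y => mink n (pcEval p t y) (pcEval p t y)) x = 0 := fun {W e x} h => by
    rw [pdR_mink (hs.differentiableAt_of_top x) (hs.differentiableAt_of_top x),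
      show pd e (pcEval p t) x = _ from eq_neg_of_add_eq_zero_left h, mink_neg_left,
      mink_neg_right, mink_smul_left, mink_smul_right, mink_comm (wedge _ _ _ _), mink_wedge_self]
    simp
  exact const_of_fderiv_du_dv (f := fun x => mink n (pcEval p t x) (pcEval p t x)) (hs.mink hs)
    (fun x => ⟨aux (p.conserved t x).1, aux (p.conserved t x).2⟩) x y

/-- The norm of `p(t)` at a given point is a polynomial in `t`. -/
theorem exists_eval_eq_mink_pcEval (x : Surf) : ∃ c : Polynomial ℝ, ∀ t : ℝ,
    mink n (pcEval p t x) (pcEval p t x) = Polynomial.eval t c := by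
  refine ⟨∑ i : Fin (n + 2), (if i = Fin.last (n + 1) then -1 else 1) *
    (∑ k ∈ Finset.range (d + 1), Polynomial.monomial k (p.coeff k x i)) ^ 2, fun t => ?_⟩
  have h : ∀ i, pcEval p t x i = Polynomial.eval t
      (∑ k ∈ Finset.range (d + 1), Polynomial.monomial k (p.coeff k x i)) := fun i => by
    simp only [pcEval, WithLp.ofLp_sum, Finset.sum_apply, PiLp.smul_apply, smul_eq_mul,
      Polynomial.eval_finsetSum, Polynomial.eval_monomial]
    exact Finset.sum_congr rfl fun j _ => mul_comm _ _
  rw [Polynomial.eval_finsetSum, Fin.sum_univ_castSucc]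
  simp only [Polynomial.eval_mul, Polynomial.eval_pow, ← h, (Fin.castSucc_lt_last _).ne, if_true,
    if_false, mink]
  simp [pow_two, sub_eq_add_neg]

/-- The differential of the top coefficient of a polynomial conserved quantity is a value of the
form `η`. -/
theorem exists_pd_top_eq (x : Surf) : ∃ b : MV n,
    pd du (p.coeff d) x = -wedge n (S.F x) (S.W₁ x) b ∧
      pd dv (p.coeff d) x = -wedge n (S.F x) (S.W₂ x) b := by
  obtain ⟨⟨hu0, hu⟩, hv0, hv⟩ := p.pd_coeff x
  rcases d with _ | k
  · refine ⟨0, ?_, ?_⟩ <;> simp [wedge, mink_comm _ (0 : MV n), mink_zero_left, hu0, hv0]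
  · exact ⟨p.coeff k x, hu k (Nat.le_succ k), hv k (Nat.le_succ k)⟩

theorem mink_F_top (x : Surf) : mink n (S.F x) (p.coeff d x) = 0 := by
  by_contra hx
  have hcont := (S.smooth_F.mink (p.smooth d)).continuous
  obtain ⟨y, hy, hy0⟩ :=
    ((S.frequently_eta_ne x).and_eventually (hcont.continuousAt.eventually_ne hx)).exists
  have h0 : ∀ e, pd e (p.coeff (d + 1)) y = 0 := fun e => by
    rw [p.coeff_eq_zero (d + 1) (Nat.lt_succ_self d)]
    simp [pd]
  obtain ⟨⟨-, hu⟩, -, hv⟩ := p.pd_coeff y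
  have hu' := hu d le_rfl
  have hv' := hv d le_rfl
  rw [h0, eq_comm, neg_eq_zero] at hu' hv'
  rcases hy with h | h
  · exact hy0 (mink_eq_zero_of_wedge_eq_zero hu' h)
  · exact hy0 (mink_eq_zero_of_wedge_eq_zero hv' h)

theorem fderiv_top_mem (x e : Surf) :
    fderiv ℝ (p.coeff d) x e ∈ Submodule.span ℝ {S.F x, pd du S.F x, pd dv S.F x} := by
  obtain ⟨b, hu, hv⟩ := p.exists_pd_top_eq x
  obtain ⟨h1, h2⟩ := S.W_mem_span x
  have hF : S.F x ∈ Submodule.span ℝ {S.F x, pd du S.F x, pd dv S.F x} :=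
    Submodule.subset_span (by simp)
  have hw : ∀ W ∈ Submodule.span ℝ {S.F x, pd du S.F x, pd dv S.F x},
      -wedge n (S.F x) W b ∈ Submodule.span ℝ {S.F x, pd du S.F x, pd dv S.F x} := fun W hW =>
    neg_mem (sub_mem (Submodule.smul_mem _ _ hW) (Submodule.smul_mem _ _ hF))
  rw [eq_of_map_du_dv]
  refine add_mem (Submodule.smul_mem _ _ ?_) (Submodule.smul_mem _ _ ?_)
  · exact (congrArg (· ∈ _) hu).mpr (hw _ h1)
  · exact (congrArg (· ∈ _) hv).mpr (hw _ h2)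

theorem mink_pd_F_top (x : Surf) :
    mink n (pd du S.F x) (p.coeff d x) = 0 ∧ mink n (pd dv S.F x) (p.coeff d x) = 0 := by
  obtain ⟨b, hu, hv⟩ := p.exists_pd_top_eq x
  constructor
  · rw [mink_pd_eq_neg S.smooth_F (p.smooth d) p.mink_F_top, hu]
    simp [wedge, mink_sub_right, mink_smul_right, S.F_null x, S.W₁_perp x]
  · rw [mink_pd_eq_neg S.smooth_F (p.smooth d) p.mink_F_top, hv]
    simp [wedge, mink_sub_right, mink_smul_right, S.F_null x, S.W₂_perp x]

/-- The top coefficient of a polynomial conserved quantity is orthogonal to the Laplacian of the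
lift. -/
theorem mink_laplacian_top (x : Surf) :
    gVV n S.F x * mink n (pd du (pd du S.F) x) (p.coeff d x)
      - 2 * gUV n S.F x * mink n (pd du (pd dv S.F) x) (p.coeff d x)
      + gUU n S.F x * mink n (pd dv (pd dv S.F) x) (p.coeff d x) = 0 := by
  obtain ⟨b, hu, hv⟩ := p.exists_pd_top_eq x
  have hFu := contDiff_pd S.smooth_F du
  have hFv := contDiff_pd S.smooth_F dv
  rw [mink_pd_eq_neg hFu (p.smooth d) fun y => (p.mink_pd_F_top y).1,
    mink_pd_eq_neg hFv (p.smooth d) fun y => (p.mink_pd_F_top y).2,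
    mink_pd_eq_neg hFv (p.smooth d) fun y => (p.mink_pd_F_top y).2, hu, hv]
  simp only [wedge, mink_neg_right, mink_sub_right, mink_smul_right,
    mink_comm (pd _ S.F x) (S.F x), S.mink_F_pd]
  linear_combination mink n (S.F x) b * S.trace_eq_zero x

theorem mink_top_of_mem_Vcsc (x : Surf) {v : MV n} (hv : v ∈ Vcsc n S x) :
    mink n (p.coeff d x) v = 0 := by
  rw [mink_comm]
  have hle : Vcsc n S x ≤ mperp n (Submodule.span ℝ {p.coeff d x}) := by
    refine Submodule.span_le.2 ?_
    have hm : ∀ v : MV n, mink n v (p.coeff d x) = 0 →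
        v ∈ mperp n (Submodule.span ℝ {p.coeff d x}) := fun v h u hu => by
      obtain ⟨c, rfl⟩ := Submodule.mem_span_singleton.1 hu
      rw [mink_smul_right, h, mul_zero]
    rintro v (rfl | rfl | rfl | rfl)
    · exact hm _ (p.mink_F_top x)
    · exact hm _ (p.mink_pd_F_top x).1
    · exact hm _ (p.mink_pd_F_top x).2
    · refine hm _ ?_
      rw [mink_add_left, mink_sub_left, mink_smul_left, mink_smul_left, mink_smul_left]
      exact p.mink_laplacian_top x
  exact hle hv _ (Submodule.mem_span_singleton_self _)

end PolyConservedQuantity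

/-- Proposition (§2): basic properties of a polynomial conserved quantity:
`p₀` is constant, `p_d` is a normally-parallel section of `V_csc^⊥`, and
`(p(t),p(t))` has constant coefficients. -/
theorem pcq_basic_properties (n d : ℕ) (S : IsothermicSurface n)
    (p : PolyConservedQuantity n S d) :
    (∀ x y : Surf, p.coeff 0 x = p.coeff 0 y)
    ∧ (∀ x, ∀ v ∈ Vcsc n S x, mink n (p.coeff d x) v = 0)
    ∧ (∀ x e, fderiv ℝ (p.coeff d) x e ∈ Vcsc n S x)
    ∧ (∃ c : Polynomial ℝ, ∀ (t : ℝ) (x : Surf),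
        mink n (pcEval p t x) (pcEval p t x) = Polynomial.eval t c) := by
  refine ⟨fun x y => ?_, fun x v hv => p.mink_top_of_mem_Vcsc x hv, fun x e => ?_, ?_⟩
  · exact const_of_fderiv_du_dv (p.smooth 0)
      (fun x => ⟨(p.pd_coeff x).1.1, (p.pd_coeff x).2.1⟩) x y
  · refine Submodule.span_mono ?_ (p.fderiv_top_mem x e)
    rintro v (rfl | rfl | rfl) <;> simp
  · obtain ⟨c, hc⟩ := p.exists_eval_eq_mink_pcEval 0
    exact ⟨c, fun t x => (p.mink_pcEval_const t x 0).trans (hc t)⟩
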